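/- arXiv:2504.19727 — 10 statements merged into one kernel-verified Lean document; each statement's English description precedes it below -/
import Mathlib

section
/- For every natural number n, the number of partitions of n in which every odd part appears at most once equals the number of partitions of n in which no part is congruent to 2 modulo 4. -/
/-- `pod n` is the number of partitions of `n` in which every odd part
appears at most once. -/
noncomputable def pod (n : ℕ) : ℕ :=
  Nat.card {p : n.Partition // ∀ a : ℕ, Odd a → p.parts.count a ≤ 1}

/-- `c n` is the number of partitions of `n` in which no part is
congruent to 2 modulo 4. -/
noncomputable def c (n : ℕ) : ℕ :=
  Nat.card {p : n.Partition // ∀ a ∈ p.parts, a % 4 ≠ 2}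

open PowerSeries PowerSeries.WithPiTopology Nat.Partition

theorem pod_eq_card_filter (n : ℕ) :
    pod n = (Finset.univ.filter fun p : n.Partition ↦
      ∀ a ∈ p.parts, Odd a → p.parts.count a ≤ 1).card := by
  refine Nat.subtype_card _ fun p ↦ ?_
  simp only [Finset.mem_filter, Finset.mem_univ, true_and]
  refine ⟨fun h a ha ↦ ?_, fun h a _ ↦ h a⟩
  by_cases hp : a ∈ p.parts
  · exact h a hp ha
  · simp [Multiset.count_eq_zero_of_notMem hp]

section GeneratingFunctions

variable (R : Type*) [CommRing R] [TopologicalSpace R]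

/-- The product of `1 - X ^ (2 * i)` over the odd `i` is the product of `1 - X ^ i` over the `i`
congruent to `2` modulo `4`. -/
theorem tprod_one_sub_X_pow_two_mul_odd :
    ∏' i : ℕ, (if Odd (i + 1) then 1 - (X : R⟦X⟧) ^ (2 * (i + 1)) else 1) =
      ∏' i : ℕ, (if (i + 1) % 4 ≠ 2 then 1 else 1 - (X : R⟦X⟧) ^ (i + 1)) := by
  symm
  refine tprod_eq_tprod_of_ne_one_bij (fun i ↦ 2 * i.val + 1) ?_ ?_ ?_
  · intro a b h
    exact Subtype.ext (by simpa using h)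
  · intro i hi
    have h : (i + 1) % 4 = 2 := by
      by_contra h
      simp [h] at hi
    have hodd : Odd (i / 2 + 1) := by grind
    have hi' : 2 * (i / 2 + 1) = i + 1 := by lia
    refine ⟨⟨i / 2, ?_⟩, by lia⟩
    simpa [h, hodd, hi'] using hi
  · rintro ⟨i, hi⟩
    have hodd : Odd (i + 1) := by
      by_contra h
      simp [h] at hi
    have h : (2 * i + 1 + 1) % 4 = 2 := by grind
    simp [hodd, h, mul_add]

variable [T2Space R] [IsTopologicalRing R]

/-- The generating function of `c` is `∏ 1 / (1 - X ^ i)` over the `i` not congruent to `2`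
modulo `4`. -/
theorem hasProd_powerSeriesMk_c :
    HasProd (fun i ↦ if (i + 1) % 4 ≠ 2 then ∑' j : ℕ, X ^ ((i + 1) * j) else 1)
      (PowerSeries.mk fun n ↦ (c n : R)) := by
  convert! hasProd_powerSeriesMk_card_restricted R (fun a ↦ a % 4 ≠ 2) using 4 with n
  rw [c, Nat.card_eq_fintype_card, Fintype.card_subtype, restricted]

/-- The generating function of `pod` is `∏ (1 + X ^ i)` over odd `i` times `∏ 1 / (1 - X ^ i)` over
even `i`. -/
theorem hasProd_powerSeriesMk_pod :
    HasProd (fun i ↦ if Odd (i + 1) then 1 + X ^ (i + 1) else ∑' j : ℕ, X ^ ((i + 1) * j))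
      (PowerSeries.mk fun n ↦ (pod n : R)) := by
  convert! hasProd_genFun (fun i k ↦ if Odd i → k ≤ 1 then (1 : R) else 0) using 1
  · ext1 i
    split_ifs with h
    · rw [tsum_eq_single 0 fun j hj ↦ by simp [h, hj]]
      simp
    · rw [tsum_eq_zero_add' ?_]
      · simp [h]
      simp_rw [pow_mul, pow_add]
      apply Summable.mul_right
      exact summable_pow_of_constantCoeff_eq_zero (by simp)
  · ext n
    rw [coeff_mk, coeff_genFun, pod_eq_card_filter, Finset.card_filter]
    push_cast
    refine Finset.sum_congr rfl fun p _ ↦ ?_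
    rw [Finsupp.prod, Finset.prod_boole]
    simp

/-- The generating functions of `pod` and `c` agree. -/
theorem powerSeriesMk_pod_eq_powerSeriesMk_c [Nontrivial R] [NoZeroDivisors R] :
    (PowerSeries.mk fun n ↦ (pod n : R)) = PowerSeries.mk fun n ↦ (c n : R) := by
  have hsum (i : ℕ) : (∑' j : ℕ, (X : R⟦X⟧) ^ ((i + 1) * j)) * (1 - X ^ (i + 1)) = 1 := by
    simp_rw [pow_mul]
    exact tsum_pow_mul_one_sub_of_constantCoeff_eq_zero (by simp)
  apply mul_right_cancel₀ (tprod_one_sub_X_pow_ne_zero R)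
  have hpod := hasProd_powerSeriesMk_pod R
  have hc := hasProd_powerSeriesMk_c R
  rw [← hpod.tprod_eq, ← hc.tprod_eq,
    ← hpod.multipliable.tprod_mul (multipliable_one_sub_X_pow R),
    ← hc.multipliable.tprod_mul (multipliable_one_sub_X_pow R)]
  simp_rw [ite_mul, hsum, one_mul]
  rw [← tprod_one_sub_X_pow_two_mul_odd]
  refine tprod_congr fun i ↦ ?_
  split_ifs <;> ring

end GeneratingFunctions

theorem pod_eq_c (n : ℕ) : pod n = c n := by
  let _ : TopologicalSpace ℤ := ⊥
  have _ : DiscreteTopology ℤ := ⟨rfl⟩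
  simpa using PowerSeries.ext_iff.mp (powerSeriesMk_pod_eq_powerSeriesMk_c ℤ) n
end

section
/- For every natural number n > 1, o1(n) + o1(n - 1) = pod(n). -/
/-- `o1 n` is the number of partitions of `n` in which every odd part
appears at most once and the largest part is even. -/
noncomputable def o1 (n : ℕ) : ℕ :=
  Nat.card {p : n.Partition //
    (∀ a : ℕ, Odd a → p.parts.count a ≤ 1) ∧ Even p.parts.sup}

theorem Multiset.sup_mem_of_ne_zero {α : Type*} [LinearOrder α] [OrderBot α] {m : Multiset α}
    (hm : m ≠ 0) : m.sup ∈ m := by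
  induction m using Multiset.induction_on with
  | empty => exact absurd rfl hm
  | cons a t ih =>
    rw [Multiset.sup_cons]
    rcases eq_or_ne t 0 with rfl | ht
    · simp
    · rcases max_choice a t.sup with h | h <;> rw [h]
      · exact Multiset.mem_cons_self a t
      · exact Multiset.mem_cons_of_mem (ih ht)

theorem Nat.Partition.parts_ne_zero {n : ℕ} (hn : 0 < n) (p : n.Partition) : p.parts ≠ 0 := by
  intro h
  have := p.parts_sum
  simp only [h, Multiset.sum_zero] at this
  omega

theorem Nat.Partition.sup_parts_mem {n : ℕ} (hn : 0 < n) (p : n.Partition) :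
    p.parts.sup ∈ p.parts :=
  Multiset.sup_mem_of_ne_zero (p.parts_ne_zero hn)

theorem Nat.Partition.one_lt_sup_parts {n : ℕ} (hn : 1 < n) (p : n.Partition)
    (hp : ∀ a : ℕ, Odd a → p.parts.count a ≤ 1) : 1 < p.parts.sup := by
  by_contra! h
  have hrep : p.parts = Multiset.replicate (Multiset.card p.parts) 1 :=
    Multiset.eq_replicate_card.2 fun b hb =>
      le_antisymm ((Multiset.le_sup hb).trans h) (p.parts_pos hb)
  have hsum := p.parts_sum
  have hcount := hp 1 odd_one
  rw [hrep, Multiset.count_replicate_self] at hcount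
  rw [hrep, Multiset.sum_replicate, smul_eq_mul, mul_one] at hsum
  omega

theorem Multiset.sup_cons_of_forall_le {α : Type*} [SemilatticeSup α] [OrderBot α] {a : α}
    {t : Multiset α} (h : ∀ b ∈ t, b ≤ a) : (a ::ₘ t).sup = a := by
  rw [Multiset.sup_cons, sup_eq_left, Multiset.sup_le]
  exact h

/-- Decrease one copy of the largest part of a partition by one. -/
def Nat.Partition.decrLargest {n : ℕ} (p : n.Partition) (h : 1 < p.parts.sup) (hn : 0 < n) :
    (n - 1).Partition where
  parts := (p.parts.sup - 1) ::ₘ p.parts.erase p.parts.sup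
  parts_pos := by
    intro i hi
    rcases Multiset.mem_cons.1 hi with rfl | hi
    · omega
    · exact p.parts_pos (Multiset.mem_of_mem_erase hi)
  parts_sum := by
    have := Multiset.sum_erase (p.sup_parts_mem hn)
    rw [p.parts_sum] at this
    rw [Multiset.sum_cons]
    omega

/-- Increase one copy of the largest part of a partition by one. -/
def Nat.Partition.incrLargest {n : ℕ} (hn : 1 < n) (p : (n - 1).Partition) : n.Partition where
  parts := (p.parts.sup + 1) ::ₘ p.parts.erase p.parts.sup
  parts_pos := by
    intro i hi
    rcases Multiset.mem_cons.1 hi with rfl | hi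
    · omega
    · exact p.parts_pos (Multiset.mem_of_mem_erase hi)
  parts_sum := by
    have := Multiset.sum_erase (p.sup_parts_mem (by omega))
    rw [p.parts_sum] at this
    rw [Multiset.sum_cons]
    omega

theorem Nat.Partition.sup_decrLargest {n : ℕ} (p : n.Partition) (h : 1 < p.parts.sup) (hn : 0 < n)
    (hc : p.parts.count p.parts.sup ≤ 1) :
    (p.decrLargest h hn).parts.sup = p.parts.sup - 1 := by
  refine Multiset.sup_cons_of_forall_le fun b hb => ?_
  have hle := Multiset.le_sup (Multiset.mem_of_mem_erase hb)
  have hne : b ≠ p.parts.sup := by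
    intro hbs
    have hpos := Multiset.count_pos.2 hb
    rw [hbs, Multiset.count_erase_self] at hpos
    omega
  omega

theorem Nat.Partition.sup_incrLargest {n : ℕ} (hn : 1 < n) (p : (n - 1).Partition) :
    (p.incrLargest hn).parts.sup = p.parts.sup + 1 :=
  Multiset.sup_cons_of_forall_le fun _ hb =>
    (Multiset.le_sup (Multiset.mem_of_mem_erase hb)).trans (Nat.le_succ _)

/-- Decreasing the largest part is a bijection from the partitions of `n` with distinct odd parts
and odd largest part to the partitions of `n - 1` with distinct odd parts and even largest part. -/
def Nat.Partition.oddLargestEquiv {n : ℕ} (hn : 1 < n) :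
    {p : n.Partition // (∀ a : ℕ, Odd a → p.parts.count a ≤ 1) ∧ ¬Even p.parts.sup} ≃
      {p : (n - 1).Partition // (∀ a : ℕ, Odd a → p.parts.count a ≤ 1) ∧ Even p.parts.sup} where
  toFun p := by
    refine ⟨p.1.decrLargest (p.1.one_lt_sup_parts hn p.2.1) (by omega), fun a ha => ?_, ?_⟩
    · have hne : a ≠ p.1.parts.sup - 1 := by
        have heven := (Nat.not_even_iff_odd.1 p.2.2).tsub_odd odd_one
        rintro rfl
        exact Nat.not_even_iff_odd.2 ha heven
      simp only [decrLargest, Multiset.count_cons_of_ne hne]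
      exact (Multiset.count_le_of_le a (Multiset.erase_le _ _)).trans (p.2.1 a ha)
    · rw [sup_decrLargest _ _ _ (p.2.1 _ (Nat.not_even_iff_odd.1 p.2.2))]
      exact (Nat.not_even_iff_odd.1 p.2.2).tsub_odd odd_one
  invFun p := by
    refine ⟨p.1.incrLargest hn, fun a ha => ?_, ?_⟩
    · have hle := Multiset.count_le_of_le a (Multiset.erase_le p.1.parts.sup p.1.parts)
      simp only [incrLargest, Multiset.count_cons]
      split_ifs with h
      · have : p.1.parts.count a = 0 := Multiset.count_eq_zero.2 fun hm => by
          have := Multiset.le_sup hm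
          omega
        omega
      · exact hle.trans (p.2.1 a ha)
    · rw [sup_incrLargest]
      exact Nat.not_even_iff_odd.2 p.2.2.add_one
  left_inv p := by
    have h := p.1.one_lt_sup_parts hn p.2.1
    apply Subtype.ext
    apply Nat.Partition.ext
    simp only [incrLargest]
    rw [sup_decrLargest _ _ _ (p.2.1 _ (Nat.not_even_iff_odd.1 p.2.2)), Nat.sub_add_cancel h.le]
    simp only [decrLargest, Multiset.erase_cons_head]
    exact Multiset.cons_erase (p.1.sup_parts_mem (by omega))
  right_inv p := by
    apply Subtype.ext
    apply Nat.Partition.ext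
    simp only [decrLargest]
    rw [sup_incrLargest, Nat.add_sub_cancel]
    simp only [incrLargest, Multiset.erase_cons_head]
    exact Multiset.cons_erase (p.1.sup_parts_mem (by omega))

theorem o1_add_o1_eq_pod (n : ℕ) (hn : 1 < n) : o1 n + o1 (n - 1) = pod n := by
  classical
  unfold o1 pod
  rw [← Nat.card_congr (Nat.Partition.oddLargestEquiv hn)]
  simp only [Nat.card_eq_fintype_card, Fintype.card_subtype, ← Finset.filter_filter]
  exact Finset.card_filter_add_card_filter_not _
end

section
/- For every natural number n > 4, o2(n) + o2(n - 3) = pod_{>2}(n). -/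
/-- `podGT2 n` is the number of partitions of `n` in which every odd part
appears at most once and every part is greater than 2. -/
noncomputable def podGT2 (n : ℕ) : ℕ :=
  Nat.card {p : n.Partition //
    (∀ a : ℕ, Odd a → p.parts.count a ≤ 1) ∧ ∀ a ∈ p.parts, 2 < a}

/-- `o2 n` is the number of partitions of `n` in which every odd part
appears at most once, the largest part is even, and the largest part
appears at least twice. -/
noncomputable def o2 (n : ℕ) : ℕ :=
  Nat.card {p : n.Partition //
    (∀ a : ℕ, Odd a → p.parts.count a ≤ 1) ∧ Even p.parts.sup ∧
      2 ≤ p.parts.count p.parts.sup}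

/-- Every odd element of the multiset occurs at most once. -/
def OddDistinct (s : Multiset ℕ) : Prop :=
  ∀ a : ℕ, Odd a → s.count a ≤ 1

namespace OddDistinct

theorem zero : OddDistinct 0 := by simp [OddDistinct]

theorem cons_iff {a : ℕ} {s : Multiset ℕ} :
    OddDistinct (a ::ₘ s) ↔ OddDistinct s ∧ (Odd a → a ∉ s) := by
  constructor
  · refine fun h => ⟨fun b hb => (Multiset.count_le_count_cons b a s).trans (h b hb),
      fun ha hs => ?_⟩
    have h1 := h a ha
    have h2 := Multiset.count_pos.2 hs
    rw [Multiset.count_cons_self] at h1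
    omega
  · rintro ⟨h, ha⟩ b hb
    have h1 := h b hb
    rw [Multiset.count_cons]
    split_ifs with hba
    · subst hba
      rw [Multiset.count_eq_zero.2 (ha hb)]
    · exact h1

theorem map_add_iff {c : ℕ} (hc : Even c) {s : Multiset ℕ} :
    OddDistinct (s.map (· + c)) ↔ OddDistinct s := by
  have key (a : ℕ) : (s.map (· + c)).count (a + c) = s.count a :=
    Multiset.count_map_eq_count' (· + c) s (add_left_injective c) a
  constructor
  · intro h a ha
    rw [← key]
    exact h _ (ha.add_even hc)
  · intro h a ha
    by_cases hca : c ≤ a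
    · obtain ⟨b, rfl⟩ := Nat.exists_eq_add_of_le' hca
      rw [key]
      exact h b ((Nat.odd_add.1 ha).2 hc)
    · rw [Multiset.count_eq_zero.2]
      · exact zero_le_one
      · simp only [Multiset.mem_map, not_exists, not_and]
        omega

end OddDistinct

theorem Multiset.exists_map_add_of_le {c : ℕ} {s : Multiset ℕ} (h : ∀ a ∈ s, c ≤ a) :
    ∃ t : Multiset ℕ, s = t.map (· + c) := by
  refine ⟨s.map (· - c), ?_⟩
  rw [Multiset.map_map]
  conv_lhs => rw [← Multiset.map_id s]
  refine Multiset.map_congr rfl fun a ha => ?_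
  simp [Nat.sub_add_cancel (h a ha)]

theorem Multiset.sum_map_add_const (c : ℕ) (s : Multiset ℕ) :
    (s.map (· + c)).sum = s.sum + s.card * c := by
  simp [Multiset.sum_map_add]

/-- Conjugation of 2-modular diagrams, as a relation between multisets `s` of `k` natural numbers
(zeros allowed) and multisets `t` of positive integers at most `2 * k`, both with distinct odd
elements. -/
inductive ModConj : ℕ → Multiset ℕ → Multiset ℕ → Prop
  | nil : ModConj 0 0 0
  | cons_zero {k : ℕ} {s t : Multiset ℕ} : ModConj k s t → ModConj (k + 1) (0 ::ₘ s) t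
  | cons_one {k : ℕ} {s t : Multiset ℕ} : ModConj k s t →
      ModConj (k + 1) (1 ::ₘ s.map (· + 2)) ((2 * k + 1) ::ₘ t)
  | add_two {k : ℕ} {s t : Multiset ℕ} : ModConj (k + 1) s t →
      ModConj (k + 1) (s.map (· + 2)) ((2 * k + 2) ::ₘ t)

namespace ModConj

variable {k : ℕ} {s s' t t' : Multiset ℕ}

theorem zero_iff : ModConj 0 s t ↔ s = 0 ∧ t = 0 := by
  constructor
  · rintro ⟨⟩
    simp
  · rintro ⟨rfl, rfl⟩
    exact nil

theorem succ_iff : ModConj (k + 1) s t ↔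
    (∃ s', ModConj k s' t ∧ s = 0 ::ₘ s') ∨
    (∃ s' t', ModConj k s' t' ∧ s = 1 ::ₘ s'.map (· + 2) ∧ t = (2 * k + 1) ::ₘ t') ∨
    ∃ s' t', ModConj (k + 1) s' t' ∧ s = s'.map (· + 2) ∧ t = (2 * k + 2) ::ₘ t' := by
  constructor
  · intro h
    cases h with
    | cons_zero h => exact Or.inl ⟨_, h, rfl⟩
    | cons_one h => exact Or.inr (Or.inl ⟨_, _, h, rfl, rfl⟩)
    | add_two h => exact Or.inr (Or.inr ⟨_, _, h, rfl, rfl⟩)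
  · rintro (⟨_, h, rfl⟩ | ⟨_, _, h, rfl, rfl⟩ | ⟨_, _, h, rfl, rfl⟩)
    exacts [h.cons_zero, h.cons_one, h.add_two]

theorem card_left (h : ModConj k s t) : s.card = k := by
  induction h <;> simp_all

theorem sum_eq (h : ModConj k s t) : s.sum = t.sum := by
  induction h with
  | nil => rfl
  | cons_zero _ ih => simpa using ih
  | cons_one h ih =>
    rw [Multiset.sum_cons, Multiset.sum_cons, Multiset.sum_map_add_const, h.card_left, ih]
    ring
  | add_two h ih =>
    rw [Multiset.sum_cons, Multiset.sum_map_add_const, h.card_left, ih]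
    ring

theorem right_mem (h : ModConj k s t) : ∀ a ∈ t, 0 < a ∧ a ≤ 2 * k := by
  induction h with
  | nil => simp
  | cons_zero _ ih => exact fun a ha => ⟨(ih a ha).1, by have := (ih a ha).2; omega⟩
  | cons_one _ ih =>
    intro a ha
    rcases Multiset.mem_cons.1 ha with rfl | ha
    · omega
    · have := ih a ha
      omega
  | add_two _ ih =>
    intro a ha
    rcases Multiset.mem_cons.1 ha with rfl | ha
    · omega
    · exact ih a ha

theorem sup_cons_cons (h : ModConj k s t) : ((2 * k) ::ₘ (2 * k) ::ₘ t).sup = 2 * k := by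
  have ht : t.sup ≤ 2 * k := Multiset.sup_le.2 fun a ha => (h.right_mem a ha).2
  rw [Multiset.sup_cons, Multiset.sup_cons, sup_eq_left.2 ht, sup_idem]

theorem oddDistinct_left (h : ModConj k s t) : OddDistinct s := by
  induction h with
  | nil => exact .zero
  | cons_zero _ ih => exact OddDistinct.cons_iff.2 ⟨ih, by simp⟩
  | cons_one _ ih =>
    exact OddDistinct.cons_iff.2 ⟨(OddDistinct.map_add_iff even_two).2 ih, by simp⟩
  | add_two _ ih => exact (OddDistinct.map_add_iff even_two).2 ih

theorem oddDistinct_right (h : ModConj k s t) : OddDistinct t := by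
  induction h with
  | nil => exact .zero
  | cons_zero _ ih => exact ih
  | cons_one h ih =>
    refine OddDistinct.cons_iff.2 ⟨ih, fun _ hm => ?_⟩
    have := h.right_mem _ hm
    omega
  | add_two _ ih => exact OddDistinct.cons_iff.2 ⟨ih, fun ho => absurd ho (by simp [parity_simps])⟩

theorem right_unique (h : ModConj k s t) (h' : ModConj k s t') : t = t' := by
  induction h generalizing t' with
  | nil => exact (zero_iff.1 h').2.symm
  | cons_zero h ih =>
    rcases succ_iff.1 h' with ⟨_, h₁, e⟩ | ⟨_, _, h₁, e, rfl⟩ | ⟨_, _, h₁, e, rfl⟩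
    · rw [Multiset.cons_inj_right] at e
      exact ih (e ▸ h₁)
    all_goals
      have := e ▸ Multiset.mem_cons_self 0 _
      simp at this
  | cons_one h ih =>
    rcases succ_iff.1 h' with ⟨_, h₁, e⟩ | ⟨_, _, h₁, e, rfl⟩ | ⟨_, _, h₁, e, rfl⟩
    · have := e.symm ▸ Multiset.mem_cons_self 0 _
      simp at this
    · rw [Multiset.cons_inj_right] at e
      rw [ih (Multiset.map_injective (add_left_injective 2) e ▸ h₁)]
    · have := e ▸ Multiset.mem_cons_self 1 _
      simp at this
  | add_two h ih =>
    rcases succ_iff.1 h' with ⟨_, h₁, e⟩ | ⟨_, _, h₁, e, rfl⟩ | ⟨_, _, h₁, e, rfl⟩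
    · have := e.symm ▸ Multiset.mem_cons_self 0 _
      simp at this
    · have := e.symm ▸ Multiset.mem_cons_self 1 _
      simp at this
    · rw [ih (Multiset.map_injective (add_left_injective 2) e ▸ h₁)]

theorem left_unique (h : ModConj k s t) (h' : ModConj k s' t) : s = s' := by
  induction h generalizing s' with
  | nil => exact (zero_iff.1 h').1.symm
  | cons_zero h ih =>
    rcases succ_iff.1 h' with ⟨_, h₁, rfl⟩ | ⟨_, _, h₁, rfl, e⟩ | ⟨_, _, h₁, rfl, e⟩
    · rw [ih h₁]
    all_goals
      have := h.right_mem _ (e ▸ Multiset.mem_cons_self _ _)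
      omega
  | cons_one h ih =>
    rcases succ_iff.1 h' with ⟨_, h₁, rfl⟩ | ⟨_, _, h₁, rfl, e⟩ | ⟨_, _, h₁, rfl, e⟩
    · have := h₁.right_mem _ (Multiset.mem_cons_self _ _)
      omega
    · rw [Multiset.cons_inj_right] at e
      rw [ih (e ▸ h₁)]
    · rcases Multiset.mem_cons.1 (e.symm ▸ Multiset.mem_cons_self _ _) with he | hm
      · omega
      · have := h.right_mem _ hm
        omega
  | add_two h ih =>
    rcases succ_iff.1 h' with ⟨_, h₁, rfl⟩ | ⟨_, _, h₁, rfl, e⟩ | ⟨_, _, h₁, rfl, e⟩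
    · have := h₁.right_mem _ (Multiset.mem_cons_self _ _)
      omega
    · rcases Multiset.mem_cons.1 (e ▸ Multiset.mem_cons_self _ _) with he | hm
      · omega
      · have := h₁.right_mem _ hm
        omega
    · rw [Multiset.cons_inj_right] at e
      rw [ih (e ▸ h₁)]

theorem exists_right (hs : OddDistinct s) (hk : s.card = k) : ∃ t, ModConj k s t := by
  induction k generalizing s with
  | zero => exact ⟨0, zero_iff.2 ⟨Multiset.card_eq_zero.1 hk, rfl⟩⟩
  | succ k ihk =>
    induction hn : s.sum using Nat.strong_induction_on generalizing s with
    | _ n ih =>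
      subst hn
      by_cases h0 : 0 ∈ s
      · obtain ⟨s, rfl⟩ := Multiset.exists_cons_of_mem h0
        obtain ⟨t, ht⟩ := ihk (OddDistinct.cons_iff.1 hs).1 (by simpa using hk)
        exact ⟨t, ht.cons_zero⟩
      by_cases h1 : 1 ∈ s
      · obtain ⟨s, rfl⟩ := Multiset.exists_cons_of_mem h1
        obtain ⟨hs, h1s⟩ := OddDistinct.cons_iff.1 hs
        obtain ⟨s, rfl⟩ := Multiset.exists_map_add_of_le (c := 2) (s := s) fun a ha => by
          have h2 : a ≠ 0 := fun h => h0 (h ▸ Multiset.mem_cons_of_mem ha)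
          have h3 : a ≠ 1 := fun h => h1s odd_one (h ▸ ha)
          omega
        obtain ⟨t, ht⟩ := ihk ((OddDistinct.map_add_iff even_two).1 hs) (by simpa using hk)
        exact ⟨_, ht.cons_one⟩
      · obtain ⟨s, rfl⟩ := Multiset.exists_map_add_of_le (c := 2) (s := s) fun a ha => by
          have h2 : a ≠ 0 := fun h => h0 (h ▸ ha)
          have h3 : a ≠ 1 := fun h => h1 (h ▸ ha)
          omega
        rw [Multiset.card_map] at hk
        obtain ⟨t, ht⟩ := ih s.sum (by rw [Multiset.sum_map_add_const]; omega)
          ((OddDistinct.map_add_iff even_two).1 hs) hk rfl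
        exact ⟨_, ht.add_two⟩

theorem exists_left (ht : OddDistinct t) (hk : ∀ a ∈ t, 0 < a ∧ a ≤ 2 * k) :
    ∃ s, ModConj k s t := by
  induction k generalizing t with
  | zero =>
    refine ⟨0, zero_iff.2 ⟨rfl, Multiset.eq_zero_of_forall_notMem fun a ha => ?_⟩⟩
    have := hk a ha
    omega
  | succ k ihk =>
    induction hn : t.sum using Nat.strong_induction_on generalizing t with
    | _ n ih =>
      subst hn
      by_cases h2 : 2 * k + 2 ∈ t
      · obtain ⟨t, rfl⟩ := Multiset.exists_cons_of_mem h2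
        obtain ⟨s, hs⟩ := ih t.sum (by rw [Multiset.sum_cons]; omega)
          (OddDistinct.cons_iff.1 ht).1 (fun a ha => hk a (Multiset.mem_cons_of_mem ha)) rfl
        exact ⟨_, hs.add_two⟩
      by_cases h1 : 2 * k + 1 ∈ t
      · obtain ⟨t, rfl⟩ := Multiset.exists_cons_of_mem h1
        obtain ⟨ht, h1t⟩ := OddDistinct.cons_iff.1 ht
        obtain ⟨s, hs⟩ := ihk ht fun a ha => by
          have h3 := hk a (Multiset.mem_cons_of_mem ha)
          have h4 : a ≠ 2 * k + 2 := fun h => h2 (h ▸ Multiset.mem_cons_of_mem ha)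
          have h5 : a ≠ 2 * k + 1 := fun h => h1t (by simp) (h ▸ ha)
          omega
        exact ⟨_, hs.cons_one⟩
      · obtain ⟨s, hs⟩ := ihk ht fun a ha => by
          have h3 := hk a ha
          have h4 : a ≠ 2 * k + 2 := fun h => h2 (h ▸ ha)
          have h5 : a ≠ 2 * k + 1 := fun h => h1 (h ▸ ha)
          omega
        exact ⟨_, hs.cons_zero⟩

end ModConj

theorem Nat.card_subtype_eq_of_relation {α β : Type*} {P : α → Prop} {Q : β → Prop}
    (R : α → β → Prop) (hP : ∀ a, P a → ∃ b, Q b ∧ R a b) (hQ : ∀ b, Q b → ∃ a, P a ∧ R a b)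
    (hl : ∀ a a' b, R a b → R a' b → a = a') (hr : ∀ a b b', R a b → R a b' → b = b') :
    Nat.card {a // P a} = Nat.card {b // Q b} := by
  choose f hf hfR using hP
  refine Nat.card_congr (Equiv.ofBijective
    (fun a : {a // P a} => (⟨f a a.2, hf a a.2⟩ : {b // Q b})) ⟨?_, ?_⟩)
  · intro a a' h
    have h1 : f a a.2 = f a' a'.2 := congrArg Subtype.val h
    exact Subtype.ext (hl _ _ _ (hfR a a.2) (h1 ▸ hfR a' a'.2))
  · rintro ⟨b, hb⟩
    obtain ⟨a, ha, hab⟩ := hQ b hb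
    exact ⟨⟨a, ha⟩, Subtype.ext (hr _ _ _ (hfR a ha) hab)⟩

theorem Nat.Partition.card_subtype_parts (n : ℕ) (P : Multiset ℕ → Prop) :
    Nat.card {p : n.Partition // P p.parts} =
      Nat.card {s : Multiset ℕ // (∀ a ∈ s, 0 < a) ∧ s.sum = n ∧ P s} := by
  refine Nat.card_subtype_eq_of_relation (fun p s => p.parts = s) ?_ ?_ ?_ ?_
  · exact fun p hp => ⟨p.parts, ⟨fun _ => p.parts_pos, p.parts_sum, hp⟩, rfl⟩
  · exact fun s hs => ⟨⟨s, fun h => hs.1 _ h, hs.2.1⟩, hs.2.2, rfl⟩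
  · exact fun p p' s h h' => Nat.Partition.ext (h.trans h'.symm)
  · exact fun p s s' h h' => h.symm.trans h'

/-- Conjugating 2-modular diagrams turns a repeated even largest part into all parts being at
least four. -/
theorem o2_eq_card_four_le {n : ℕ} (hn : 0 < n) :
    o2 n = Nat.card {p : n.Partition // OddDistinct p.parts ∧ ∀ a ∈ p.parts, 4 ≤ a} := by
  rw [o2, Nat.Partition.card_subtype_parts n fun s => (∀ a : ℕ, Odd a → s.count a ≤ 1) ∧
      Even s.sup ∧ 2 ≤ s.count s.sup,
    Nat.Partition.card_subtype_parts n fun s => OddDistinct s ∧ ∀ a ∈ s, 4 ≤ a]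
  refine Nat.card_subtype_eq_of_relation (fun p q => ∃ k s t, ModConj k s t ∧
    p = (2 * k) ::ₘ (2 * k) ::ₘ t ∧ q = s.map (· + 4)) ?_ ?_ ?_ ?_
  · rintro p ⟨hpos, hsum, hodd, ⟨k, hk⟩, hcount⟩
    rw [← two_mul] at hk
    have hle : ∀ a ∈ p, a ≤ 2 * k := fun a ha => hk ▸ Multiset.le_sup ha
    rw [hk] at hcount
    obtain ⟨p, rfl⟩ := Multiset.exists_cons_of_mem
      (Multiset.count_pos.1 (by omega : 0 < p.count (2 * k)))
    rw [Multiset.count_cons_self] at hcount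
    obtain ⟨t, rfl⟩ := Multiset.exists_cons_of_mem
      (Multiset.count_pos.1 (by omega : 0 < p.count (2 * k)))
    obtain ⟨s, hs⟩ := ModConj.exists_left (t := t) (k := k)
      (OddDistinct.cons_iff.1 (OddDistinct.cons_iff.1 hodd).1).1
      (fun a ha => ⟨hpos a (by simp [ha]), hle a (by simp [ha])⟩)
    refine ⟨s.map (· + 4), ⟨by simp, ?_, ?_, by simp⟩, k, s, t, hs, rfl, rfl⟩
    · rw [← hsum, Multiset.sum_map_add_const, hs.sum_eq, hs.card_left, Multiset.sum_cons,
        Multiset.sum_cons]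
      ring
    · exact (OddDistinct.map_add_iff (by decide)).2 hs.oddDistinct_left
  · rintro q ⟨-, hsum, hodd, hfour⟩
    obtain ⟨s, rfl⟩ := Multiset.exists_map_add_of_le hfour
    obtain ⟨t, ht⟩ := ModConj.exists_right ((OddDistinct.map_add_iff (by decide)).1 hodd) rfl
    have hk : 0 < s.card := by
      refine Multiset.card_pos.2 ?_
      rintro rfl
      simp at hsum
      omega
    refine ⟨_, ⟨fun a ha => ?_, ?_, ?_, ?_, ?_⟩, _, s, t, ht, rfl, rfl⟩
    · simp only [Multiset.mem_cons, or_self_left] at ha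
      rcases ha with rfl | ha
      · omega
      · exact (ht.right_mem a ha).1
    · rw [← hsum, Multiset.sum_map_add_const, ht.sum_eq, Multiset.sum_cons, Multiset.sum_cons]
      ring
    · have he : ¬ Odd (2 * s.card) := by simp
      exact OddDistinct.cons_iff.2 ⟨OddDistinct.cons_iff.2
        ⟨ht.oddDistinct_right, fun h => absurd h he⟩, fun h => absurd h he⟩
    · rw [ht.sup_cons_cons]
      exact even_two_mul _
    · rw [ht.sup_cons_cons, Multiset.count_cons_self, Multiset.count_cons_self]
      omega
  · rintro _ _ _ ⟨k, s, t, h, rfl, rfl⟩ ⟨k', s', t', h', rfl, e⟩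
    obtain rfl := Multiset.map_injective (add_left_injective 4) e
    obtain rfl := h.card_left.symm.trans h'.card_left
    rw [h.right_unique h']
  · rintro _ _ _ ⟨k, s, t, h, rfl, rfl⟩ ⟨k', s', t', h', e, rfl⟩
    have hkk := congrArg Multiset.sup e
    rw [h.sup_cons_cons, h'.sup_cons_cons] at hkk
    obtain rfl : k = k' := by omega
    rw [Multiset.cons_inj_right, Multiset.cons_inj_right] at e
    rw [h.left_unique (e ▸ h')]

theorem o2_add_o2_eq_podGT2 (n : ℕ) (hn : 4 < n) :
    o2 n + o2 (n - 3) = podGT2 n := by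
  rw [o2_eq_card_four_le (by omega), o2_eq_card_four_le (by omega), podGT2,
    ← Nat.card_congr (Equiv.sumCompl fun p : {p : n.Partition //
      (∀ a : ℕ, Odd a → p.parts.count a ≤ 1) ∧ ∀ a ∈ p.parts, 2 < a} => 3 ∉ p.1.parts),
    Nat.card_sum]
  congr 1
  · rw [Nat.card_congr (Equiv.subtypeSubtypeEquivSubtypeInter (fun p : n.Partition =>
        (∀ a : ℕ, Odd a → p.parts.count a ≤ 1) ∧ ∀ a ∈ p.parts, 2 < a) fun p => 3 ∉ p.parts)]
    refine Nat.card_congr (Equiv.subtypeEquivRight fun p => ?_)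
    refine ⟨fun ⟨h, h4⟩ => ⟨⟨h, fun a ha => ?_⟩, fun h3 => ?_⟩, fun ⟨⟨h, h2⟩, h3⟩ =>
      ⟨h, fun a ha => ?_⟩⟩
    · have := h4 a ha
      omega
    · have := h4 3 h3
      omega
    · have := h2 a ha
      have : a ≠ 3 := fun e => h3 (e ▸ ha)
      omega
  · rw [Nat.card_congr (Equiv.subtypeSubtypeEquivSubtypeInter (fun p : n.Partition =>
        (∀ a : ℕ, Odd a → p.parts.count a ≤ 1) ∧ ∀ a ∈ p.parts, 2 < a) fun p => ¬ 3 ∉ p.parts),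
      Nat.Partition.card_subtype_parts _ fun s => OddDistinct s ∧ ∀ a ∈ s, 4 ≤ a,
      Nat.Partition.card_subtype_parts n fun s =>
        ((∀ a : ℕ, Odd a → s.count a ≤ 1) ∧ ∀ a ∈ s, 2 < a) ∧ ¬ 3 ∉ s]
    refine Nat.card_subtype_eq_of_relation (fun s t => t = 3 ::ₘ s) ?_ ?_ ?_ ?_
    · rintro s ⟨hpos, hsum, hodd, hfour⟩
      have hmem : ∀ a ∈ 3 ::ₘ s, 2 < a := fun a ha => by
        rcases Multiset.mem_cons.1 ha with rfl | ha
        · omega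
        · have := hfour a ha
          omega
      refine ⟨_, ⟨fun a ha => (hmem a ha).pos, ?_, ⟨OddDistinct.cons_iff.2
        ⟨hodd, fun _ h => absurd (hfour 3 h) (by omega)⟩, hmem⟩, by simp⟩, rfl⟩
      rw [Multiset.sum_cons]
      omega
    · rintro t ⟨hpos, hsum, ⟨hodd, htwo⟩, hthree⟩
      obtain ⟨s, rfl⟩ := Multiset.exists_cons_of_mem (not_not.1 hthree)
      obtain ⟨hodd, h3⟩ := OddDistinct.cons_iff.1 hodd
      rw [Multiset.sum_cons] at hsum
      refine ⟨s, ⟨fun a ha => hpos a (Multiset.mem_cons_of_mem ha), by omega, hodd,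
        fun a ha => ?_⟩, rfl⟩
      have := htwo a (Multiset.mem_cons_of_mem ha)
      have : a ≠ 3 := fun e => h3 (by decide) (e ▸ ha)
      omega
    · rintro s s' _ rfl e
      exact (Multiset.cons_inj_right _).1 e
    · rintro s _ _ rfl rfl
      rfl
end

section
/- For every natural number n > 1, o1(n) + o1(n - 1) = c(n). -/
namespace Multiset

theorem sup_mem_of_pos {s : Multiset ℕ} (h : 0 < s.sup) : s.sup ∈ s := by
  induction s using Multiset.induction with
  | empty => simp at h
  | cons a t ih =>
    rw [sup_cons] at h ⊢
    rcases le_total t.sup a with hle | hle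
    · simp [sup_eq_left.mpr hle]
    · rw [sup_eq_right.mpr hle] at h ⊢
      exact mem_cons_of_mem (ih h)

/-- Replace each part congruent to 2 modulo 4 by two copies of its half. -/
def splitTwoModFour (s : Multiset ℕ) : Multiset ℕ :=
  s.bind fun a ↦ if a % 4 = 2 then {a / 2, a / 2} else {a}

/-- Merge as many pairs of equal odd parts as possible. -/
def mergeOdd (s : Multiset ℕ) : Multiset ℕ :=
  ∑ a ∈ s.toFinset, if a % 2 = 1 then
    replicate (s.count a % 2) a + replicate (s.count a / 2) (2 * a) else replicate (s.count a) a

theorem sum_splitTwoModFour (s : Multiset ℕ) : s.splitTwoModFour.sum = s.sum := by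
  unfold splitTwoModFour
  induction s using Multiset.induction with
  | empty => simp
  | cons a t ih =>
    rw [cons_bind, sum_add, ih, sum_cons]
    congr 1
    split_ifs
    · simp; omega
    · simp

theorem count_splitTwoModFour (s : Multiset ℕ) (b : ℕ) :
    s.splitTwoModFour.count b =
      if b % 2 = 1 then s.count b + 2 * s.count (2 * b) else
        if b % 4 = 2 then 0 else s.count b := by
  unfold splitTwoModFour
  induction s using Multiset.induction with
  | empty => simp
  | cons a t ih =>
    rw [cons_bind, count_add, ih]
    by_cases ha : a % 4 = 2
    · simp only [ha, if_true, insert_eq_cons, count_cons, count_singleton]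
      grind
    · simp only [ha, if_false, count_cons, count_singleton]
      grind

theorem sum_mergeOdd (s : Multiset ℕ) : s.mergeOdd.sum = s.sum := by
  rw [mergeOdd, sum_sum, Finset.sum_multiset_count s]
  refine Finset.sum_congr rfl fun a _ ↦ ?_
  split_ifs
  · simp only [sum_add, sum_replicate, smul_eq_mul]
    nlinarith [Nat.mod_add_div (s.count a) 2]
  · simp

theorem count_mergeOdd (s : Multiset ℕ) (hs : ∀ a ∈ s, a % 4 ≠ 2) (b : ℕ) :
    s.mergeOdd.count b =
      if b % 2 = 1 then s.count b % 2 else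
        if b % 4 = 2 then s.count (b / 2) / 2 else s.count b := by
  rw [mergeOdd, count_sum']
  rw [Finset.sum_eq_single (if b % 4 = 2 then b / 2 else b)]
  · by_cases h2 : b % 4 = 2
    · have : b / 2 % 2 = 1 := by omega
      have h3 : b / 2 ≠ b := by omega
      have h4 : 2 * (b / 2) = b := by omega
      have h5 : b % 2 ≠ 1 := by omega
      simp [h2, this, count_replicate, h3, h4, h5]
    · simp only [h2, if_false]
      split_ifs with h
      · have : 2 * b ≠ b := by omega
        simp [count_replicate, this]
      · simp
  · intro a ha hne
    have h4 := hs a (mem_toFinset.mp ha)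
    split_ifs with h <;> simp only [count_add, count_replicate] <;> grind
  · intro h
    have : s.count (if b % 4 = 2 then b / 2 else b) = 0 := by simpa using h
    simp [this]

theorem mergeOdd_splitTwoModFour {s : Multiset ℕ} (hs : ∀ a, Odd a → s.count a ≤ 1) :
    s.splitTwoModFour.mergeOdd = s := by
  have hc := count_splitTwoModFour s
  have h : ∀ a ∈ s.splitTwoModFour, a % 4 ≠ 2 := by
    intro a ha h2
    have := hc a
    rw [← count_pos] at ha
    grind
  ext b
  rw [count_mergeOdd _ h, hc, hc]
  have := hs b
  rw [Nat.odd_iff] at this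
  split_ifs <;> try omega
  have h4 : 2 * (b / 2) = b := by omega
  have := hs (b / 2) (Nat.odd_iff.mpr (by omega))
  rw [h4]
  omega

theorem splitTwoModFour_mergeOdd {s : Multiset ℕ} (hs : ∀ a ∈ s, a % 4 ≠ 2) :
    s.mergeOdd.splitTwoModFour = s := by
  ext b
  rw [count_splitTwoModFour, count_mergeOdd _ hs, count_mergeOdd _ hs]
  have h4 : 2 * b / 2 = b := by omega
  rw [h4]
  by_cases h2 : b % 4 = 2
  · have : s.count b = 0 := count_eq_zero.mpr fun hb ↦ hs b hb h2
    grind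
  · grind

theorem lt_sup_of_mem_erase_sup {s : Multiset ℕ} (hs : s.count s.sup ≤ 1) {a : ℕ}
    (ha : a ∈ s.erase s.sup) : a < s.sup := by
  refine lt_of_le_of_ne (le_sup (mem_of_mem_erase ha)) ?_
  rintro rfl
  rw [← count_pos, count_erase_self] at ha
  omega

theorem sup_cons_of_forall_le_s4 {a : ℕ} {t : Multiset ℕ} (h : ∀ b ∈ t, b ≤ a) :
    (a ::ₘ t).sup = a := by
  rw [sup_cons]
  exact sup_eq_left.mpr (sup_le.mpr h)

end Multiset

namespace Nat.Partition

/-- Splitting parts congruent to 2 modulo 4 into halves is a bijection from partitions with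
distinct odd parts onto partitions without parts congruent to 2 modulo 4. -/
def oddDistinctEquiv (n : ℕ) :
    {p : n.Partition // ∀ a : ℕ, Odd a → p.parts.count a ≤ 1} ≃
      {p : n.Partition // ∀ a ∈ p.parts, a % 4 ≠ 2} where
  toFun p := ⟨⟨p.1.parts.splitTwoModFour, by
      intro i hi
      by_contra h0
      have h := Multiset.count_splitTwoModFour p.1.parts i
      rw [← Multiset.count_pos] at hi
      have : p.1.parts.count 0 = 0 :=
        Multiset.count_eq_zero.mpr fun h ↦ lt_irrefl _ (p.1.parts_pos h)
      grind, by rw [Multiset.sum_splitTwoModFour, p.1.parts_sum]⟩, by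
      intro a ha h2
      have h := Multiset.count_splitTwoModFour p.1.parts a
      rw [← Multiset.count_pos] at ha
      grind⟩
  invFun p := ⟨⟨p.1.parts.mergeOdd, by
      intro i hi
      by_contra h0
      have h := Multiset.count_mergeOdd p.1.parts p.2 i
      rw [← Multiset.count_pos] at hi
      have : p.1.parts.count 0 = 0 :=
        Multiset.count_eq_zero.mpr fun h ↦ lt_irrefl _ (p.1.parts_pos h)
      grind, by rw [Multiset.sum_mergeOdd, p.1.parts_sum]⟩, by
      intro a ha
      have h := Multiset.count_mergeOdd p.1.parts p.2 a
      rw [Nat.odd_iff] at ha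
      rw [if_pos ha] at h
      change Multiset.count a p.1.parts.mergeOdd ≤ 1
      omega⟩
  left_inv p := Subtype.ext (Nat.Partition.ext (Multiset.mergeOdd_splitTwoModFour p.2))
  right_inv p := Subtype.ext (Nat.Partition.ext (Multiset.splitTwoModFour_mergeOdd p.2))

theorem sup_parts_mem_s4 {n : ℕ} (hn : n ≠ 0) (p : n.Partition) : p.parts.sup ∈ p.parts := by
  apply Multiset.sup_mem_of_pos
  obtain ⟨a, ha⟩ : ∃ a, a ∈ p.parts := by
    apply Multiset.exists_mem_of_ne_zero
    intro h
    have := p.parts_sum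
    simp_all
  exact (p.parts_pos ha).trans_le (Multiset.le_sup ha)

/-- Decreasing the largest part by one is a bijection from partitions of `n + 1` with distinct odd
parts and odd largest part onto partitions of `n` with distinct odd parts and even largest part. -/
def oddLargestEquiv_s4 {n : ℕ} (hn : n ≠ 0) :
    {p : (n + 1).Partition //
      (∀ a : ℕ, Odd a → p.parts.count a ≤ 1) ∧ ¬ Even p.parts.sup} ≃
    {p : n.Partition //
      (∀ a : ℕ, Odd a → p.parts.count a ≤ 1) ∧ Even p.parts.sup} where
  toFun p := ⟨⟨(p.1.parts.sup - 1) ::ₘ p.1.parts.erase p.1.parts.sup, by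
      obtain ⟨p, hp, he⟩ := p
      have hm := sup_parts_mem_s4 n.succ_ne_zero p
      have hlt (a) := Multiset.lt_sup_of_mem_erase_sup (a := a) (hp _ (Nat.not_even_iff_odd.mp he))
      have hsum := congrArg Multiset.sum (Multiset.cons_erase hm)
      rw [Multiset.sum_cons, p.parts_sum] at hsum
      intro i hi
      rcases Multiset.mem_cons.mp hi with rfl | hi
      · by_contra h0
        have h1 : p.parts.erase p.parts.sup = 0 := by
          refine Multiset.eq_zero_of_forall_notMem fun a ha ↦ ?_
          have := hlt a ha
          have := p.parts_pos (Multiset.mem_of_mem_erase ha)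
          simp only at h0
          omega
        rw [h1] at hsum
        simp only [Multiset.sum_zero] at hsum h0
        omega
      · exact p.parts_pos (Multiset.mem_of_mem_erase hi), by
      have hm := sup_parts_mem_s4 n.succ_ne_zero p.1
      have hpos := p.1.parts_pos hm
      have hsum := congrArg Multiset.sum (Multiset.cons_erase hm)
      rw [Multiset.sum_cons, p.1.parts_sum] at hsum
      rw [Multiset.sum_cons]
      omega⟩, by
      obtain ⟨p, hp, he⟩ := p
      have ho := Nat.not_even_iff_odd.mp he
      have hlt (a) := Multiset.lt_sup_of_mem_erase_sup (a := a) (hp _ ho)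
      constructor
      · intro a ha
        rw [Multiset.count_cons_of_ne (by rintro rfl; simp only at ha; grind)]
        exact (Multiset.count_le_of_le a (Multiset.erase_le _ _)).trans (hp a ha)
      · rw [Multiset.sup_cons_of_forall_le_s4 fun b hb ↦ Nat.le_sub_one_of_lt (hlt b hb)]
        grind⟩
  invFun p := ⟨⟨(p.1.parts.sup + 1) ::ₘ p.1.parts.erase p.1.parts.sup, by
      intro i hi
      rcases Multiset.mem_cons.mp hi with rfl | hi
      · omega
      · exact p.1.parts_pos (Multiset.mem_of_mem_erase hi), by
      have hm := sup_parts_mem_s4 hn p.1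
      have hsum := congrArg Multiset.sum (Multiset.cons_erase hm)
      rw [Multiset.sum_cons, p.1.parts_sum] at hsum
      rw [Multiset.sum_cons]
      omega⟩, by
      obtain ⟨p, hp, he⟩ := p
      have hle (b) (hb : b ∈ p.parts.erase p.parts.sup) : b ≤ p.parts.sup :=
        Multiset.le_sup (Multiset.mem_of_mem_erase hb)
      constructor
      · intro a ha
        have h1 := (Multiset.count_le_of_le a (Multiset.erase_le p.parts.sup _)).trans (hp a ha)
        by_cases h : a = p.parts.sup + 1
        · subst h
          have : (p.parts.erase p.parts.sup).count (p.parts.sup + 1) = 0 :=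
            Multiset.count_eq_zero.mpr fun hb ↦ by have := hle _ hb; omega
          simp [this]
        · rwa [Multiset.count_cons_of_ne h]
      · rw [Multiset.sup_cons_of_forall_le_s4 fun b hb ↦ (hle b hb).trans (Nat.le_succ _)]
        grind⟩
  left_inv := by
    rintro ⟨p, hp, he⟩
    apply Subtype.ext
    apply Nat.Partition.ext
    have hm := sup_parts_mem_s4 n.succ_ne_zero p
    have hlt (a) := Multiset.lt_sup_of_mem_erase_sup (a := a) (hp _ (Nat.not_even_iff_odd.mp he))
    simp only [Multiset.sup_cons_of_forall_le_s4 fun b hb ↦ Nat.le_sub_one_of_lt (hlt b hb),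
      Multiset.erase_cons_head, Nat.sub_add_cancel (p.parts_pos hm), Multiset.cons_erase hm]
  right_inv := by
    rintro ⟨p, hp, he⟩
    apply Subtype.ext
    apply Nat.Partition.ext
    have hle (b) (hb : b ∈ p.parts.erase p.parts.sup) : b ≤ p.parts.sup + 1 :=
      (Multiset.le_sup (Multiset.mem_of_mem_erase hb)).trans (Nat.le_succ _)
    simp only [Multiset.sup_cons_of_forall_le_s4 hle, Multiset.erase_cons_head,
      Nat.add_sub_cancel, Multiset.cons_erase (sup_parts_mem_s4 hn p)]

end Nat.Partition

theorem o1_add_o1_eq_c (n : ℕ) (hn : 1 < n) : o1 n + o1 (n - 1) = c n := by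
  obtain ⟨m, rfl⟩ := Nat.exists_eq_add_of_lt (Nat.zero_lt_of_lt hn)
  rw [zero_add] at hn ⊢
  rw [Nat.add_sub_cancel, o1, o1, c,
    ← Nat.card_congr (Nat.Partition.oddLargestEquiv_s4 (show m ≠ 0 by omega)),
    ← Nat.card_congr (Nat.Partition.oddDistinctEquiv (m + 1))]
  classical
  rw [← Nat.card_congr (Equiv.sumCompl fun p : {p : (m + 1).Partition //
      ∀ a : ℕ, Odd a → p.parts.count a ≤ 1} ↦ Even p.1.parts.sup), Nat.card_sum]
  exact congrArg₂ (· + ·)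
    (Nat.card_congr (Equiv.subtypeSubtypeEquivSubtypeInter _ _).symm)
    (Nat.card_congr (Equiv.subtypeSubtypeEquivSubtypeInter _ _).symm)
end

section
/- For every complex number q with |q| < 1, the series \sum_{n=0}^{\infty} o1(n) q^n converges absolutely and equals (-q^3; q^2)_{\infty} / (q^2; q^2)_{\infty}, i.e. \prod_{j=0}^{\infty} (1 + q^{2j+3}) / \prod_{j=0}^{\infty} (1 - q^{2j+2}), where both infinite products converge. -/
open Finset PowerSeries Filter Topology

theorem hasSum_of_monotone_of_tendsto {a : ℕ → ℕ → ℝ} {g : ℕ → ℝ} {z L : ℂ} {w : ℕ → ℂ}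
    {b : ℕ → ℝ} {B : ℝ} (ha0 : ∀ N n, 0 ≤ a N n) (hmono : ∀ n, Monotone (a · n))
    (hlim : ∀ n, Tendsto (a · n) atTop (𝓝 (g n)))
    (hb : ∀ N, HasSum (fun n ↦ a N n * ‖z‖ ^ n) (b N)) (hB : ∀ N, b N ≤ B)
    (hw : ∀ N, HasSum (fun n ↦ (a N n : ℂ) * z ^ n) (w N)) (hL : Tendsto w atTop (𝓝 L)) :
    HasSum (fun n ↦ (g n : ℂ) * z ^ n) L := by
  have hle (N n) : a N n ≤ g n := (hmono n).ge_of_tendsto (hlim n) N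
  have hg0 (n) : 0 ≤ g n := (ha0 0 n).trans (hle 0 n)
  have hgs : Summable (fun n ↦ g n * ‖z‖ ^ n) := by
    refine summable_of_sum_range_le (c := B) (fun n ↦ mul_nonneg (hg0 n) (by positivity)) fun M ↦ ?_
    have ht : Tendsto (fun N ↦ ∑ n ∈ range M, a N n * ‖z‖ ^ n) atTop
        (𝓝 (∑ n ∈ range M, g n * ‖z‖ ^ n)) :=
      tendsto_finsetSum _ fun n _ ↦ (hlim n).mul_const _
    exact le_of_tendsto' ht fun N ↦ (sum_le_hasSum _
      (fun n _ ↦ mul_nonneg (ha0 N n) (by positivity)) (hb N)).trans (hB N)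
  have hs : Summable (fun n ↦ (g n : ℂ) * z ^ n) :=
    .of_norm (by simpa [abs_of_nonneg (hg0 _)] using hgs)
  have ht := tendsto_tsum_of_dominated_convergence (𝓕 := atTop)
    (f := fun N n ↦ (a N n : ℂ) * z ^ n) (g := fun n ↦ (g n : ℂ) * z ^ n) hgs
    (fun n ↦ ((Complex.continuous_ofReal.tendsto _).comp (hlim n)).mul_const _)
    (.of_forall fun N n ↦ by
      simp only [norm_mul, Complex.norm_real, Real.norm_eq_abs, abs_of_nonneg (ha0 N n), norm_pow]
      gcongr
      exact hle N n)
  simp only [fun N ↦ (hw N).tsum_eq] at ht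
  rw [tendsto_nhds_unique hL ht]
  exact hs.hasSum

namespace PowerSeries

theorem hasSum_coeff_mul {A B : ℝ⟦X⟧} {z a b : ℂ}
    (hA : HasSum (fun n ↦ (A.coeff n : ℂ) * z ^ n) a)
    (hB : HasSum (fun n ↦ (B.coeff n : ℂ) * z ^ n) b) :
    HasSum (fun n ↦ ((A * B).coeff n : ℂ) * z ^ n) (a * b) := by
  have key (n : ℕ) : ((A * B).coeff n : ℂ) * z ^ n = ∑ kl ∈ antidiagonal n,
      ((A.coeff kl.1 : ℂ) * z ^ kl.1) * ((B.coeff kl.2 : ℂ) * z ^ kl.2) := by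
    rw [coeff_mul, Complex.ofReal_sum, Finset.sum_mul]
    refine Finset.sum_congr rfl fun kl hkl ↦ ?_
    rw [← mem_antidiagonal.mp hkl, pow_add]
    push_cast
    ring
  have hAn := hA.summable.norm
  have hBn := hB.summable.norm
  simp only [key]
  rw [← hA.tsum_eq, ← hB.tsum_eq,
    tsum_mul_tsum_eq_tsum_sum_antidiagonal_of_summable_norm hAn hBn]
  exact (summable_norm_sum_mul_antidiagonal_of_summable_norm hAn hBn).of_norm.hasSum

theorem hasSum_coeff_prod {ι : Type*} (s : Finset ι) {A : ι → ℝ⟦X⟧} {z : ℂ} {a : ι → ℂ}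
    (hA : ∀ i ∈ s, HasSum (fun n ↦ ((A i).coeff n : ℂ) * z ^ n) (a i)) :
    HasSum (fun n ↦ ((∏ i ∈ s, A i).coeff n : ℂ) * z ^ n) (∏ i ∈ s, a i) := by
  classical
  induction s using Finset.induction_on with
  | empty =>
    convert! hasSum_ite_eq 0 (1 : ℂ) using 2 with n
    by_cases hn : n = 0 <;> simp [coeff_one, hn]
  | insert i s hi ih =>
    rw [prod_insert hi, prod_insert hi]
    exact hasSum_coeff_mul (hA i (mem_insert_self i s))
      (ih fun j hj ↦ hA j (mem_insert_of_mem hj))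

theorem coeff_prod_nonneg {ι : Type*} (s : Finset ι) {A : ι → ℝ⟦X⟧}
    (hA : ∀ i n, 0 ≤ (A i).coeff n) (n : ℕ) : 0 ≤ (∏ i ∈ s, A i).coeff n := by
  classical
  rw [coeff_prod]
  exact sum_nonneg fun _ _ ↦ prod_nonneg fun i _ ↦ hA i _

theorem monotone_coeff_prod_range {A : ℕ → ℝ⟦X⟧} (hA : ∀ i n, 0 ≤ (A i).coeff n)
    (hA0 : ∀ i, (A i).coeff 0 = 1) (n : ℕ) :
    Monotone fun N ↦ (∏ i ∈ range N, A i).coeff n := by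
  refine monotone_nat_of_le_succ fun N ↦ ?_
  rw [prod_range_succ, coeff_mul]
  have := single_le_sum (f := fun kl : ℕ × ℕ ↦
      (∏ i ∈ range N, A i).coeff kl.1 * (A N).coeff kl.2)
    (fun kl _ ↦ mul_nonneg (coeff_prod_nonneg _ hA _) (hA _ _))
    (show (n, 0) ∈ antidiagonal n by simp)
  simpa [hA0] using this

end PowerSeries

namespace Nat.Partition

open scoped PowerSeries.WithPiTopology

/-- The factor attached to parts of size `m` in the product formula for `Nat.Partition.genFun`. -/
noncomputable def genFunFactor (f : ℕ → ℕ → ℝ) (m : ℕ) : ℝ⟦X⟧ :=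
  1 + ∑' j, f m (j + 1) • (X : ℝ⟦X⟧) ^ (m * (j + 1))

theorem coeff_genFunFactor (f : ℕ → ℕ → ℝ) {m : ℕ} (hm : m ≠ 0) (n : ℕ) :
    (genFunFactor f m).coeff n =
      (if n = 0 then 1 else 0) + ∑' j, if n = m * (j + 1) then f m (j + 1) else 0 := by
  rw [genFunFactor, map_add, coeff_one]
  congr 1
  have h := (summable_genFun_term' f hm).hasSum.map (coeff n) (WithPiTopology.continuous_coeff ℝ n)
  rw [← h.tsum_eq]
  simp [coeff_X_pow]

theorem coeff_mul_genFunFactor (f : ℕ → ℕ → ℝ) {m : ℕ} (hm : m ≠ 0) (k : ℕ) :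
    (genFunFactor f m).coeff (m * k) = if k = 0 then 1 else f m k := by
  rw [coeff_genFunFactor f hm]
  rcases k with _ | k
  · simp [hm]
  · simp only [mul_eq_mul_left_iff, hm, or_false, add_left_inj]
    rw [tsum_eq_single k (by grind)]
    simp [hm]

theorem coeff_genFunFactor_of_not_dvd (f : ℕ → ℕ → ℝ) {m : ℕ} (hm : m ≠ 0) {n : ℕ}
    (hn : ¬ m ∣ n) : (genFunFactor f m).coeff n = 0 := by
  have h (j) : n ≠ m * (j + 1) := fun h ↦ hn ⟨_, h⟩
  have h0 : n ≠ 0 := by rintro rfl; simp at hn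
  simp [coeff_genFunFactor f hm, h, h0]

theorem coeff_genFunFactor_nonneg {f : ℕ → ℕ → ℝ} (hf : ∀ i j, 0 ≤ f i j) {m : ℕ} (hm : m ≠ 0)
    (n : ℕ) : 0 ≤ (genFunFactor f m).coeff n := by
  rw [coeff_genFunFactor f hm]
  refine add_nonneg (by positivity) (tsum_nonneg fun j ↦ ?_)
  split_ifs
  exacts [hf _ _, le_rfl]

theorem hasSum_coeff_genFunFactor {f : ℕ → ℕ → ℝ} {m : ℕ} (hm : m ≠ 0) {z v : ℂ}
    (h : HasSum (fun k ↦ ((if k = 0 then 1 else f m k : ℝ) : ℂ) * z ^ (m * k)) v) :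
    HasSum (fun n ↦ ((genFunFactor f m).coeff n : ℂ) * z ^ n) v := by
  rw [← (mul_right_injective₀ hm).hasSum_iff]
  · simpa only [Function.comp_def, coeff_mul_genFunFactor f hm] using h
  · intro n hn
    rw [coeff_genFunFactor_of_not_dvd f hm (fun ⟨k, hk⟩ ↦ hn ⟨k, hk.symm⟩)]
    simp

open Classical in
/-- The partitions of `n` with distinct odd parts whose multiset of parts satisfies `P`. -/
noncomputable def oddDistinct (n : ℕ) (P : Multiset ℕ → Prop) : Finset n.Partition :=
  {p | (∀ a, Odd a → p.parts.count a ≤ 1) ∧ P p.parts}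

theorem mem_oddDistinct {n : ℕ} {P : Multiset ℕ → Prop} {p : n.Partition} :
    p ∈ oddDistinct n P ↔ (∀ a, Odd a → p.parts.count a ≤ 1) ∧ P p.parts := by
  simp [oddDistinct]

/-- The indicator that a part of size `i` may occur `c` times in a partition without ones and
with distinct odd parts. -/
noncomputable def oddDistinctNoOneWeight (i c : ℕ) : ℝ :=
  if Odd i → c ≤ 1 ∧ i ≠ 1 then 1 else 0

theorem coeff_genFun_oddDistinctNoOneWeight (n : ℕ) :
    (genFun oddDistinctNoOneWeight).coeff n =
      #(oddDistinct n (1 ∉ ·)) := by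
  rw [coeff_genFun, oddDistinct, card_filter]
  push_cast
  refine sum_congr rfl fun p _ ↦ ?_
  simp only [Finsupp.prod, oddDistinctNoOneWeight]
  rw [prod_ite_zero, prod_const_one]
  congr 1
  simp only [Multiset.toFinsupp_support, Multiset.mem_toFinset, Multiset.toFinsupp_apply, eq_iff_iff]
  refine ⟨fun h ↦ ⟨fun a ha ↦ ?_, fun h1 ↦ (h 1 h1 odd_one).2 rfl⟩, fun h i hi ho ↦ ⟨h.1 i ho, ?_⟩⟩
  · by_cases hp : a ∈ p.parts
    · exact (h a hp ha).1
    · simp [Multiset.count_eq_zero_of_notMem hp]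
  · rintro rfl
    exact h.2 hi

theorem hasSum_coeff_prod_oddDistinctNoOne {z : ℂ} (hz : ‖z‖ < 1) (N : ℕ) :
    HasSum (fun n ↦ ((∏ i ∈ range (2 * N + 1),
        genFunFactor oddDistinctNoOneWeight (i + 1)).coeff n : ℂ) * z ^ n)
      ((∏ j ∈ range N, (1 + z ^ (2 * j + 3))) / ∏ j ∈ range N, (1 - z ^ (2 * j + 2))) := by
  have hodd (i : ℕ) (hi : Odd i) (h1 : i ≠ 1) :
      HasSum (fun n ↦ ((genFunFactor oddDistinctNoOneWeight i).coeff n : ℂ) * z ^ n)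
        (1 + z ^ i) := by
    refine hasSum_coeff_genFunFactor (by rintro rfl; simp at hi) ?_
    have h := hasSum_sum_of_ne_finset_zero (s := range 2) (L := .unconditional ℕ)
      (f := fun k ↦ ((if k = 0 then 1 else oddDistinctNoOneWeight i k : ℝ) : ℂ) * z ^ (i * k))
      fun k hk ↦ by
        have : 2 ≤ k := by simpa [Nat.lt_iff_add_one_le] using hk
        have h0 : k ≠ 0 := by omega
        have h2 : ¬ k ≤ 1 := by omega
        simp [oddDistinctNoOneWeight, hi, h0, h2]
    simpa [sum_range_succ, oddDistinctNoOneWeight, h1] using h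
  have heven (i : ℕ) (hi : Even i) (h0 : i ≠ 0) :
      HasSum (fun n ↦ ((genFunFactor oddDistinctNoOneWeight i).coeff n : ℂ) * z ^ n)
        (1 - z ^ i)⁻¹ := by
    refine hasSum_coeff_genFunFactor h0 ?_
    have := hasSum_geometric_of_norm_lt_one (ξ := z ^ i)
      (by simpa using pow_lt_one₀ (norm_nonneg z) hz h0)
    simpa [oddDistinctNoOneWeight, Nat.not_odd_iff_even.mpr hi, pow_mul] using this
  have hone :
      HasSum (fun n ↦ ((genFunFactor oddDistinctNoOneWeight 1).coeff n : ℂ) * z ^ n) 1 := by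
    refine hasSum_coeff_genFunFactor one_ne_zero ?_
    convert! hasSum_ite_eq 0 (1 : ℂ) using 2 with k
    by_cases hk : k = 0 <;> simp [oddDistinctNoOneWeight, hk]
  induction N with
  | zero => simpa using hone
  | succ N ih =>
    rw [show 2 * (N + 1) + 1 = 2 * N + 1 + 1 + 1 by ring, prod_range_succ, prod_range_succ]
    convert! hasSum_coeff_mul (hasSum_coeff_mul ih (heven (2 * N + 1 + 1) ⟨N + 1, by ring⟩ (by simp)))
      (hodd (2 * N + 1 + 1 + 1) ⟨N + 1, by ring⟩ (by simp)) using 1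
    rw [prod_range_succ, prod_range_succ]
    simp only [add_assoc, div_eq_mul_inv, mul_inv]
    ring

theorem hasSum_card_oddDistinctNoOne {z : ℂ} (hz : ‖z‖ < 1) {L : ℂ → ℂ}
    (hL : ∀ z : ℂ, ‖z‖ < 1 → Tendsto (fun N ↦ (∏ j ∈ range N, (1 + z ^ (2 * j + 3))) /
      ∏ j ∈ range N, (1 - z ^ (2 * j + 2))) atTop (𝓝 (L z))) :
    HasSum (fun n ↦ (#(oddDistinct n (1 ∉ ·)) : ℂ)
      * z ^ n) (L z) := by
  have hz' : ‖(‖z‖ : ℂ)‖ < 1 := by simpa using hz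
  have hweight (i j) : 0 ≤ oddDistinctNoOneWeight i j := by
    unfold oddDistinctNoOneWeight; positivity
  have hpos (i n) := coeff_genFunFactor_nonneg hweight (Nat.succ_ne_zero i) n
  obtain ⟨B, hB⟩ := ((Complex.continuous_re.tendsto _).comp (hL _ hz')).bddAbove_range
  have hmono (n) := (monotone_coeff_prod_range hpos (fun i ↦ by
    simpa using coeff_mul_genFunFactor oddDistinctNoOneWeight (Nat.succ_ne_zero i) 0) n).comp
      (show Monotone fun N : ℕ ↦ 2 * N + 1 from fun a b hab ↦ by simpa using hab)
  have hlim (n : ℕ) := ((WithPiTopology.tendsto_iff_coeff_tendsto ℝ _ _ _).mp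
    (hasProd_genFun oddDistinctNoOneWeight).tendsto_prod_nat n).comp
      (tendsto_atTop_mono (fun N : ℕ ↦ show N ≤ 2 * N + 1 by omega) tendsto_id)
  have hnorm (N : ℕ) := Complex.hasSum_re (hasSum_coeff_prod_oddDistinctNoOne hz' N)
  simp only [← Complex.ofReal_pow, Complex.re_ofReal_mul, Complex.ofReal_re] at hnorm
  have := hasSum_of_monotone_of_tendsto (fun N n ↦ coeff_prod_nonneg _ hpos n) hmono hlim hnorm
    (fun N ↦ hB ⟨N, by simp⟩) (fun N ↦ hasSum_coeff_prod_oddDistinctNoOne hz N) (hL z hz)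
  simpa only [coeff_genFun_oddDistinctNoOneWeight, Complex.ofReal_natCast] using this

theorem _root_.Multiset.sup_mem_of_ne_zero_s6 {s : Multiset ℕ} (hs : s ≠ 0) : s.sup ∈ s := by
  induction s using Multiset.induction_on with
  | empty => exact absurd rfl hs
  | cons a s ih =>
    rw [Multiset.sup_cons]
    by_cases h : s = 0
    · simp [h]
    · rcases le_total a s.sup with h' | h'
      · simpa [h'] using Or.inr (ih h)
      · simp [h']

theorem card_oddDistinct_add_card_not (n : ℕ) (P : Multiset ℕ → Prop) :
    #(oddDistinct n P) + #(oddDistinct n (¬ P ·)) = #(oddDistinct n fun _ ↦ True) := by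
  classical
  have h := card_filter_add_card_filter_not (s := oddDistinct n fun _ ↦ True) (fun p ↦ P p.parts)
  convert! h using 3 <;> ext p <;> simp [mem_oddDistinct]

theorem card_oddDistinct_one_mem (n : ℕ) :
    #(oddDistinct (n + 1) (1 ∈ ·)) = #(oddDistinct n (1 ∉ ·)) := by
  symm
  refine card_bij (fun p _ ↦ ⟨1 ::ₘ p.parts, fun {i} hi ↦ ?_, ?_⟩) ?_ ?_ ?_
  · rcases Multiset.mem_cons.mp hi with rfl | hi
    exacts [one_pos, p.parts_pos hi]
  · simp [p.parts_sum, add_comm]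
  · intro p hp
    rw [mem_oddDistinct] at hp ⊢
    refine ⟨fun a ha ↦ ?_, by simp⟩
    rw [Multiset.count_cons]
    split_ifs with h
    · simp [h, Multiset.count_eq_zero_of_notMem hp.2]
    · exact hp.1 a ha
  · intro p _ p' _ h
    simpa [Nat.Partition.ext_iff] using h
  · intro p hp
    rw [mem_oddDistinct] at hp
    refine ⟨⟨p.parts.erase 1, fun hi ↦ p.parts_pos (Multiset.mem_of_mem_erase hi), ?_⟩, ?_, ?_⟩
    · have := p.parts_sum
      rw [← Multiset.cons_erase hp.2, Multiset.sum_cons] at this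
      omega
    · refine mem_oddDistinct.mpr ⟨fun a ha ↦ ?_, ?_⟩
      · exact (Multiset.count_le_of_le a (Multiset.erase_le _ _)).trans (hp.1 a ha)
      · rw [← Multiset.count_eq_zero, Multiset.count_erase_self]
        have := hp.1 1 odd_one
        omega
    · simp [Multiset.cons_erase hp.2]

theorem card_oddDistinct_odd_sup (n : ℕ) :
    #(oddDistinct (n + 1) (¬ Even ·.sup)) = #(oddDistinct n (Even ·.sup)) := by
  symm
  have hsup (s : Multiset ℕ) : ((s.sup + 1) ::ₘ s.erase s.sup).sup = s.sup + 1 := by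
    rw [Multiset.sup_cons, sup_eq_left]
    exact (Multiset.sup_mono (Multiset.erase_subset _ _)).trans (Nat.le_succ _)
  have hzero {n : ℕ} (p : n.Partition) : p.parts.sup = 0 ↔ p.parts = 0 := by
    refine ⟨fun h ↦ ?_, fun h ↦ by simp [h]⟩
    by_contra h0
    exact (p.parts_pos (Multiset.sup_mem_of_ne_zero_s6 h0)).ne' h
  refine card_bij (fun p _ ↦ ⟨(p.parts.sup + 1) ::ₘ p.parts.erase p.parts.sup, fun {i} hi ↦ ?_, ?_⟩)
    ?_ ?_ ?_
  · rcases Multiset.mem_cons.mp hi with rfl | hi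
    exacts [Nat.succ_pos _, p.parts_pos (Multiset.mem_of_mem_erase hi)]
  · rw [Multiset.sum_cons]
    have := p.parts_sum
    by_cases h : p.parts = 0
    · simp_all
    · rw [← Multiset.cons_erase (Multiset.sup_mem_of_ne_zero_s6 h), Multiset.sum_cons] at this
      omega
  · intro p hp
    rw [mem_oddDistinct] at hp ⊢
    refine ⟨fun a ha ↦ ?_, by simpa [hsup, Nat.even_add_one] using hp.2⟩
    have hle := Multiset.count_le_of_le a (Multiset.erase_le p.parts.sup p.parts)
    rw [Multiset.count_cons]
    split_ifs with h
    · have : a ∉ p.parts := fun h' ↦ by have := Multiset.le_sup h'; omega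
      rw [Multiset.count_eq_zero_of_notMem this] at hle
      omega
    · exact hle.trans (hp.1 a ha)
  · intro p _ p' _ h
    have h' : (p.parts.sup + 1) ::ₘ p.parts.erase p.parts.sup =
      (p'.parts.sup + 1) ::ₘ p'.parts.erase p'.parts.sup := congrArg Nat.Partition.parts h
    have hs : p.parts.sup = p'.parts.sup := by
      have := congrArg Multiset.sup h'
      rw [hsup, hsup] at this
      omega
    rw [← hs, Multiset.cons_inj_right] at h'
    refine Nat.Partition.ext ?_
    by_cases h0 : p.parts = 0
    · rw [h0, (hzero p').mp (by rw [← hs, h0]; rfl)]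
    · have h0' : p'.parts ≠ 0 := fun h ↦ h0 ((hzero p).mp (by rw [hs, h]; rfl))
      rw [← Multiset.cons_erase (Multiset.sup_mem_of_ne_zero_s6 h0), h',
        Multiset.cons_erase (hs ▸ Multiset.sup_mem_of_ne_zero_s6 h0')]
  · intro p hp
    rw [mem_oddDistinct, Nat.not_even_iff_odd] at hp
    obtain ⟨hc, k, hk⟩ := hp
    have hmem : p.parts.sup ∈ p.parts :=
      Multiset.sup_mem_of_ne_zero_s6 fun h ↦ by simp [h] at hk
    have hlt : ∀ i ∈ p.parts.erase p.parts.sup, i ≤ 2 * k := by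
      intro i hi
      have h1 := Multiset.le_sup (Multiset.mem_of_mem_erase hi)
      have h2 : i ≠ p.parts.sup := by
        rintro rfl
        have := hc p.parts.sup ⟨k, hk⟩
        rw [← Multiset.count_pos, Multiset.count_erase_self] at hi
        omega
      omega
    have hsum := p.parts_sum
    rw [← Multiset.cons_erase hmem, Multiset.sum_cons] at hsum
    set t := p.parts.erase p.parts.sup with ht
    have htc (a : ℕ) (ha : Odd a) : t.count a ≤ 1 :=
      (Multiset.count_le_of_le a (Multiset.erase_le _ _)).trans (hc a ha)
    have htpos {i : ℕ} (hi : i ∈ t) : 0 < i := p.parts_pos (Multiset.mem_of_mem_erase hi)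
    rcases Nat.eq_zero_or_pos k with rfl | hkpos
    · have ht0 : t = 0 := Multiset.eq_zero_of_forall_notMem fun i hi ↦ by
        have := hlt i hi
        have := htpos hi
        omega
      refine ⟨⟨0, by simp, by simp [ht0] at hsum ⊢; omega⟩,
        mem_oddDistinct.mpr (by simp), Nat.Partition.ext ?_⟩
      have hp : p.parts = {1} := by
        rw [← Multiset.cons_erase hmem, ← ht, ht0, hk]
        rfl
      simp [hp]
    · have hts : ((2 * k) ::ₘ t).sup = 2 * k := by
        rw [Multiset.sup_cons, sup_eq_left, Multiset.sup_le]
        exact hlt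
      refine ⟨⟨(2 * k) ::ₘ t, fun {i} hi ↦ ?_, ?_⟩, mem_oddDistinct.mpr ⟨fun a ha ↦ ?_, ?_⟩,
        Nat.Partition.ext ?_⟩
      · rcases Multiset.mem_cons.mp hi with rfl | hi
        exacts [by omega, htpos hi]
      · rw [Multiset.sum_cons]
        omega
      · have hne : a ≠ 2 * k := fun h ↦ Nat.not_even_iff_odd.mpr ha (h ▸ even_two_mul k)
        rw [Multiset.count_cons_of_ne hne]
        exact htc a ha
      · simp [hts]
      · change (((2 * k) ::ₘ t).sup + 1) ::ₘ ((2 * k) ::ₘ t).erase ((2 * k) ::ₘ t).sup = p.parts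
        rw [hts, Multiset.erase_cons_head, ← hk, ht, Multiset.cons_erase hmem]

theorem card_oddDistinct_even_sup (n : ℕ) :
    #(oddDistinct n (Even ·.sup)) = #(oddDistinct n (1 ∉ ·)) := by
  induction n with
  | zero => congr 1; ext p; simp [mem_oddDistinct]
  | succ n ih =>
    have h1 := card_oddDistinct_add_card_not (n + 1) (Even ·.sup)
    have h2 := card_oddDistinct_add_card_not (n + 1) (1 ∈ ·)
    rw [card_oddDistinct_odd_sup] at h1
    rw [card_oddDistinct_one_mem] at h2
    omega

end Nat.Partition

theorem o1_eq_card_oddDistinct (n : ℕ) :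
    o1 n = #(Nat.Partition.oddDistinct n (1 ∉ ·)) := by
  classical
  rw [← Nat.Partition.card_oddDistinct_even_sup, o1, Nat.card_eq_fintype_card,
    Fintype.card_subtype, Nat.Partition.oddDistinct]
  congr!

theorem o1_generating_function (q : ℂ) (hq : ‖q‖ < 1) :
    Summable (fun n : ℕ => ‖(o1 n : ℂ) * q ^ n‖) ∧
    Multipliable (fun j : ℕ => 1 + q ^ (2 * j + 3)) ∧
    Multipliable (fun j : ℕ => 1 - q ^ (2 * j + 2)) ∧
    ∑' n : ℕ, (o1 n : ℂ) * q ^ n =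
      (∏' j : ℕ, (1 + q ^ (2 * j + 3))) / ∏' j : ℕ, (1 - q ^ (2 * j + 2)) := by
  have hs {z : ℂ} (hz : ‖z‖ < 1) (k : ℕ) : Summable fun j : ℕ ↦ ‖z ^ (2 * j + k)‖ := by
    simp only [norm_pow]
    exact (summable_geometric_of_lt_one (norm_nonneg z) hz).comp_injective
      (i := fun j ↦ 2 * j + k) fun a b h ↦ by simpa using h
  have hnum {z : ℂ} (hz : ‖z‖ < 1) : Multipliable fun j : ℕ ↦ 1 + z ^ (2 * j + 3) :=
    multipliable_one_add_of_summable (hs hz 3)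
  have hs' {z : ℂ} (hz : ‖z‖ < 1) : Summable fun j : ℕ ↦ ‖-z ^ (2 * j + 2)‖ := by
    simpa only [norm_neg] using hs hz 2
  have hden {z : ℂ} (hz : ‖z‖ < 1) : Multipliable fun j : ℕ ↦ 1 - z ^ (2 * j + 2) := by
    simpa only [sub_eq_add_neg] using multipliable_one_add_of_summable (hs' hz)
  have hne {z : ℂ} (hz : ‖z‖ < 1) : ∏' j : ℕ, (1 - z ^ (2 * j + 2)) ≠ 0 := by
    simp only [sub_eq_add_neg]
    refine tprod_one_add_ne_zero_of_summable (fun j h ↦ ?_) (hs' hz)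
    have h1 : z ^ (2 * j + 2) = 1 := by linear_combination -h
    have h2 := pow_lt_one₀ (norm_nonneg z) hz (n := 2 * j + 2) (by omega)
    rw [← norm_pow, h1, norm_one] at h2
    exact h2.false
  have key := Nat.Partition.hasSum_card_oddDistinctNoOne hq
    (L := fun z ↦ (∏' j : ℕ, (1 + z ^ (2 * j + 3))) / ∏' j : ℕ, (1 - z ^ (2 * j + 2)))
    fun z hz ↦ (hnum hz).hasProd.tendsto_prod_nat.div (hden hz).hasProd.tendsto_prod_nat (hne hz)
  simp only [← o1_eq_card_oddDistinct] at key
  exact ⟨key.summable.norm, hnum hq, hden hq, key.tsum_eq⟩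
end

section
/- For every complex number q with |q| < 1, the series \sum_{n=0}^{\infty} (-q; q^2)_n q^{2n} / (q^2; q^2)_n converges absolutely and equals (-q^3; q^2)_{\infty} / (q^2; q^2)_{\infty}, i.e. \sum_{n=0}^{\infty} \left( \prod_{j=0}^{n-1} (1 + q^{2j+1}) \right) q^{2n} / \prod_{j=0}^{n-1} (1 - q^{2j+2}) = \prod_{j=0}^{\infty} (1 + q^{2j+3}) / \prod_{j=0}^{\infty} (1 - q^{2j+2}). -/
open Filter Topology Asymptotics

section

variable {q : ℂ}

lemma summable_norm_pow_two_mul_add (hq : ‖q‖ < 1) (k : ℕ) :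
    Summable fun j : ℕ => ‖q ^ (2 * j + k)‖ := by
  have h : ‖q‖ ^ 2 < 1 := pow_lt_one₀ (norm_nonneg q) hq two_ne_zero
  simpa [pow_add, pow_mul] using
    (summable_geometric_of_lt_one (by positivity) h).mul_right (‖q‖ ^ k)

lemma one_sub_pow_ne_zero_of_norm_lt_one (hq : ‖q‖ < 1) {n : ℕ} (hn : n ≠ 0) :
    1 - q ^ n ≠ 0 := by
  intro h
  have h1 : ‖q ^ n‖ < 1 := by simpa using pow_lt_one₀ (norm_nonneg q) hq hn
  simp [← sub_eq_zero.mp h] at h1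

lemma tendsto_prod_one_add_pow (hq : ‖q‖ < 1) (k : ℕ) :
    Tendsto (fun n => ∏ j ∈ Finset.range n, (1 + q ^ (2 * j + k))) atTop
      (𝓝 (∏' j : ℕ, (1 + q ^ (2 * j + k)))) :=
  (multipliable_one_add_of_summable
    (summable_norm_pow_two_mul_add hq k)).hasProd.tendsto_prod_nat

lemma tendsto_prod_one_sub_pow (hq : ‖q‖ < 1) (k : ℕ) :
    Tendsto (fun n => ∏ j ∈ Finset.range n, (1 - q ^ (2 * j + k))) atTop
      (𝓝 (∏' j : ℕ, (1 - q ^ (2 * j + k)))) := by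
  simp only [sub_eq_add_neg]
  exact (multipliable_one_add_of_summable (f := fun j => -q ^ (2 * j + k))
    (by simpa using summable_norm_pow_two_mul_add hq k)).hasProd.tendsto_prod_nat

lemma tprod_one_sub_pow_ne_zero (hq : ‖q‖ < 1) :
    ∏' j : ℕ, (1 - q ^ (2 * j + 2)) ≠ 0 := by
  simp only [sub_eq_add_neg]
  refine tprod_one_add_ne_zero_of_summable (f := fun j => -q ^ (2 * j + 2)) (fun j => ?_) ?_
  · simpa [sub_eq_add_neg] using
      one_sub_pow_ne_zero_of_norm_lt_one hq (n := 2 * j + 2) (by omega)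
  · simpa using summable_norm_pow_two_mul_add hq 2

/-- The partial sums of the series are themselves quotients of finite products. -/
lemma sum_range_succ_qSeries (hq : ‖q‖ < 1) (n : ℕ) :
    ∑ m ∈ Finset.range (n + 1), (∏ j ∈ Finset.range m, (1 + q ^ (2 * j + 1))) * q ^ (2 * m) /
        ∏ j ∈ Finset.range m, (1 - q ^ (2 * j + 2)) =
      (∏ j ∈ Finset.range n, (1 + q ^ (2 * j + 3))) /
        ∏ j ∈ Finset.range n, (1 - q ^ (2 * j + 2)) := by
  induction n with
  | zero => simp
  | succ n ih =>
    have hB : ∏ j ∈ Finset.range n, (1 - q ^ (2 * j + 2)) ≠ 0 :=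
      Finset.prod_ne_zero_iff.mpr fun j _ => one_sub_pow_ne_zero_of_norm_lt_one hq (by omega)
    have hb : 1 - q ^ (2 * n + 2) ≠ 0 := one_sub_pow_ne_zero_of_norm_lt_one hq (by omega)
    have hA : ∏ j ∈ Finset.range (n + 1), (1 + q ^ (2 * j + 1)) =
        (∏ j ∈ Finset.range n, (1 + q ^ (2 * j + 3))) * (1 + q) := by
      rw [Finset.prod_range_succ']
      simp [mul_add, add_assoc]
    rw [Finset.sum_range_succ, ih, hA, Finset.prod_range_succ _ n, Finset.prod_range_succ _ n,
      div_add_div _ _ hB (mul_ne_zero hB hb), div_eq_div_iff (by positivity) (by positivity)]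
    ring

end

theorem qSeries_identity (q : ℂ) (hq : ‖q‖ < 1) :
    Summable (fun n : ℕ =>
      ‖(∏ j ∈ Finset.range n, (1 + q ^ (2 * j + 1))) * q ^ (2 * n) /
        ∏ j ∈ Finset.range n, (1 - q ^ (2 * j + 2))‖) ∧
    ∑' n : ℕ, (∏ j ∈ Finset.range n, (1 + q ^ (2 * j + 1))) * q ^ (2 * n) /
        ∏ j ∈ Finset.range n, (1 - q ^ (2 * j + 2)) =
      (∏' j : ℕ, (1 + q ^ (2 * j + 3))) / ∏' j : ℕ, (1 - q ^ (2 * j + 2)) := by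
  have hB := tendsto_prod_one_sub_pow hq 2
  have hB0 := tprod_one_sub_pow_ne_zero hq
  have hsum : Summable (fun n : ℕ =>
      ‖(∏ j ∈ Finset.range n, (1 + q ^ (2 * j + 1))) * q ^ (2 * n) /
        ∏ j ∈ Finset.range n, (1 - q ^ (2 * j + 2))‖) := by
    refine summable_of_isBigO_nat (summable_norm_pow_two_mul_add hq 0) ?_
    have h := (((tendsto_prod_one_add_pow hq 1).div hB hB0).isBigO_one ℝ).norm_left.mul
      (isBigO_refl (fun n : ℕ => ‖q ^ (2 * n + 0)‖) atTop)
    refine h.congr (fun n => ?_) fun n => one_mul _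
    rw [← norm_mul, Pi.div_apply, add_zero, div_mul_eq_mul_div]
  refine ⟨hsum, tendsto_nhds_unique
    ((tendsto_add_atTop_iff_nat 1).mpr hsum.of_norm.hasSum.tendsto_sum_nat) ?_⟩
  simp only [sum_range_succ_qSeries hq]
  exact (tendsto_prod_one_add_pow hq 3).div hB hB0
end

section
/- For every complex number q with |q| < 1, the series \sum_{n=0}^{\infty} o2(n) q^n converges absolutely and equals (-q^5; q^2)_{\infty} / (q^4; q^2)_{\infty} - 1, i.e. \prod_{j=0}^{\infty} (1 + q^{2j+5}) / \prod_{j=0}^{\infty} (1 - q^{2j+4}) - 1. -/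
namespace Multiset

open Filter Topology Finset

/-- Multisets with parts in `[1, m]` in which every odd part appears at most once. -/
def oddDistinct (m : ℕ) : Set (Multiset ℕ) :=
  {s | (∀ a ∈ s, 0 < a ∧ a ≤ m) ∧ ∀ a, Odd a → s.count a ≤ 1}

/-- Multisets of positive parts in which every odd part appears at most once, and the largest part
is even and appears at least twice. -/
def oddDistinctEvenMax : Set (Multiset ℕ) :=
  {s | (∀ a ∈ s, 0 < a) ∧ (∀ a, Odd a → s.count a ≤ 1) ∧ Even s.sup ∧ 2 ≤ s.count s.sup}

/-- Splitting a multiset into the copies of `a` and the remaining elements. -/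
def splitEquiv (a : ℕ) {S T : Set (Multiset ℕ)} {C : Set ℕ} (hS : ∀ s ∈ S, a ∉ s)
    (hT : ∀ s, s ∈ T ↔ s.filter (· ≠ a) ∈ S ∧ s.count a ∈ C) : T ≃ S × C where
  toFun s := (⟨_, ((hT s).1 s.2).1⟩, ⟨_, ((hT s).1 s.2).2⟩)
  invFun x := ⟨x.1 + replicate x.2 a, (hT _).2 (by
    have h := hS _ x.1.2
    have h1 : filter (· ≠ a) x.1.1 = x.1.1 := filter_eq_self.2 fun b hb hba ↦ h (hba ▸ hb)
    have h2 : filter (· ≠ a) (replicate x.2 a) = 0 :=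
      filter_eq_nil.2 fun b hb ↦ by simp [eq_of_mem_replicate hb]
    rw [filter_add, h1, h2, count_add, count_eq_zero_of_notMem h, count_replicate_self]
    simp)⟩
  left_inv s := by
    ext b
    by_cases hb : b = a
    · subst hb
      simp
    · simp [hb, count_replicate, Ne.symm hb]
  right_inv x := by
    have h := hS _ x.1.2
    have h1 : filter (· ≠ a) x.1.1 = x.1.1 := filter_eq_self.2 fun b hb hba ↦ h (hba ▸ hb)
    have h2 : filter (· ≠ a) (replicate x.2 a) = 0 :=
      filter_eq_nil.2 fun b hb ↦ by simp [eq_of_mem_replicate hb]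
    refine Prod.ext (Subtype.ext ?_) (Subtype.ext ?_)
    · simp only [filter_add, h1, h2, add_zero]
    · simp [count_eq_zero_of_notMem h]

variable {𝕜 : Type*} [RCLike 𝕜] {q : 𝕜}

theorem hasSum_mul_of_equiv {α β γ : Type*} (e : β × γ ≃ α) {F : α → 𝕜} {f : β → 𝕜} {g : γ → 𝕜}
    {a b : 𝕜} (hf : HasSum f a) (hg : HasSum g b) (h : ∀ x, F (e x) = f x.1 * g x.2) :
    HasSum F (a * b) := by
  have hs := summable_mul_of_summable_norm hf.summable.norm hg.summable.norm
  rw [← e.hasSum_iff, show F ∘ e = fun x ↦ f x.1 * g x.2 from funext h]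
  exact hf.mul hg hs

theorem hasSum_pow_sum_of_split (a : ℕ) {S T : Set (Multiset ℕ)} {C : Set ℕ}
    (hS : ∀ s ∈ S, a ∉ s) (hT : ∀ s, s ∈ T ↔ s.filter (· ≠ a) ∈ S ∧ s.count a ∈ C) {g h : 𝕜}
    (hg : HasSum (fun s : S ↦ q ^ s.1.sum) g) (hh : HasSum (fun c : C ↦ (q ^ a) ^ c.1) h) :
    HasSum (fun s : T ↦ q ^ s.1.sum) (g * h) := by
  refine hasSum_mul_of_equiv (splitEquiv a hS hT).symm hg hh fun x ↦ ?_
  simp [splitEquiv, pow_add, ← pow_mul, mul_comm]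

theorem hasSum_geometric_le_one (x : 𝕜) : HasSum (fun c : {c : ℕ | c ≤ 1} ↦ x ^ c.1) (1 + x) := by
  have h := (Finset.range 2).hasSum (fun c ↦ x ^ c)
  have e : {c : ℕ | c ≤ 1} = ((Finset.range 2 : Finset ℕ) : Set ℕ) := by
    ext c
    simp only [Set.mem_ofPred_eq, Finset.coe_range, Set.mem_Iio]
    omega
  rw [e]
  simpa [Finset.sum_range_succ, Function.comp_def] using h

theorem hasSum_geometric_two_le {x : 𝕜} (hx : ‖x‖ < 1) :
    HasSum (fun c : {c : ℕ | 2 ≤ c} ↦ x ^ c.1) (x ^ 2 * (1 - x)⁻¹) := by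
  let e : ℕ ≃ {c : ℕ | 2 ≤ c} :=
    { toFun := fun n ↦ ⟨n + 2, by simp⟩
      invFun := fun c ↦ c.1 - 2
      left_inv := fun n ↦ by simp
      right_inv := fun c ↦ Subtype.ext (Nat.sub_add_cancel c.2) }
  rw [← e.hasSum_iff]
  have he : (fun c : {c : ℕ | 2 ≤ c} ↦ x ^ c.1) ∘ e = fun n ↦ x ^ 2 * x ^ n := by
    funext n
    simp [e, pow_add, mul_comm]
  rw [he]
  exact (hasSum_geometric_of_norm_lt_one hx).mul_left (x ^ 2)

theorem succ_notMem_of_mem_oddDistinct {m : ℕ} {s : Multiset ℕ} (hs : s ∈ oddDistinct m) :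
    m + 1 ∉ s := fun h ↦ by
  have := (hs.1 _ h).2
  omega

theorem mem_oddDistinct_succ (m : ℕ) (s : Multiset ℕ) :
    s ∈ oddDistinct (m + 1) ↔
      s.filter (· ≠ m + 1) ∈ oddDistinct m ∧ s.count (m + 1) ∈ {c | Odd (m + 1) → c ≤ 1} := by
  simp only [oddDistinct, Set.mem_ofPred_eq, mem_filter, count_filter]
  refine ⟨fun ⟨h1, h2⟩ ↦ ⟨⟨fun a ha ↦ ?_, fun a ha ↦ ?_⟩, h2 _⟩,
    fun ⟨⟨h1, h2⟩, h3⟩ ↦ ⟨fun a ha ↦ ?_, fun a ha ↦ ?_⟩⟩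
  · have := h1 a ha.1
    have := ha.2
    omega
  · have := h2 a ha
    split_ifs <;> omega
  · by_cases e : a = m + 1
    · omega
    · have := h1 a ⟨ha, e⟩
      omega
  · by_cases e : a = m + 1
    · subst e
      exact h3 ha
    · simpa [e] using h2 a ha

theorem mem_oddDistinctEvenMax_iff (k : ℕ) (s : Multiset ℕ) :
    s ∈ {s | s ∈ oddDistinctEvenMax ∧ s.sup / 2 - 1 = k} ↔
      s.filter (· ≠ 2 * k + 1 + 1) ∈ oddDistinct (2 * k + 1) ∧
        s.count (2 * k + 1 + 1) ∈ {c | 2 ≤ c} := by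
  simp only [oddDistinct, oddDistinctEvenMax, Set.mem_ofPred_eq, mem_filter, count_filter]
  constructor
  · rintro ⟨⟨h0, h1, h2, h3⟩, h4⟩
    have hs : s.sup ∈ s := count_pos.1 (by omega)
    have := h0 _ hs
    obtain ⟨j, hj⟩ := h2
    have e : s.sup = 2 * k + 1 + 1 := by omega
    refine ⟨⟨fun a ha ↦ ?_, fun a ha ↦ ?_⟩, e ▸ h3⟩
    · have := h0 a ha.1
      have := ha.2
      have := le_sup ha.1
      omega
    · have := h1 a ha
      split_ifs <;> omega
  · rintro ⟨⟨h1, h2⟩, h3⟩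
    have hmem : 2 * k + 1 + 1 ∈ s := count_pos.1 (by omega)
    have hle : ∀ a ∈ s, 0 < a ∧ a ≤ 2 * k + 1 + 1 := fun a ha ↦ by
      by_cases e : a = 2 * k + 1 + 1
      · omega
      · have := h1 a ⟨ha, e⟩
        omega
    have e : s.sup = 2 * k + 1 + 1 :=
      le_antisymm (Multiset.sup_le.2 fun a ha ↦ (hle a ha).2) (le_sup hmem)
    refine ⟨⟨fun a ha ↦ (hle a ha).1, fun a ha ↦ ?_, ⟨k + 1, by omega⟩, e ▸ h3⟩, by omega⟩
    have : a ≠ 2 * k + 1 + 1 := by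
      rintro rfl
      obtain ⟨j, hj⟩ := ha
      omega
    simpa [this] using h2 a ha

theorem hasSum_oddDistinct_odd {k : ℕ} {g : 𝕜}
    (h : HasSum (fun s : oddDistinct (2 * k) ↦ q ^ s.1.sum) g) :
    HasSum (fun s : oddDistinct (2 * k + 1) ↦ q ^ s.1.sum) (g * (1 + q ^ (2 * k + 1))) := by
  refine hasSum_pow_sum_of_split (2 * k + 1) (fun _ ↦ succ_notMem_of_mem_oddDistinct)
    (mem_oddDistinct_succ _) h ?_
  have e : {c | Odd (2 * k + 1) → c ≤ 1} = {c | c ≤ 1} := by simp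
  rw [e]
  exact hasSum_geometric_le_one _

theorem hasSum_oddDistinct (hq : ‖q‖ < 1) (k : ℕ) :
    HasSum (fun s : oddDistinct (2 * k) ↦ q ^ s.1.sum)
      (∏ i ∈ Finset.range k, (1 + q ^ (2 * i + 1)) * (1 - q ^ (2 * i + 2))⁻¹) := by
  induction k with
  | zero =>
    have e : oddDistinct (2 * 0) = {0} := by
      ext s
      simp only [oddDistinct, Set.mem_ofPred_eq, Set.mem_singleton_iff]
      refine ⟨fun h ↦ eq_zero_of_forall_notMem fun a ha ↦ ?_, fun h ↦ by simp [h]⟩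
      have := h.1 a ha
      omega
    rw [e]
    simpa using hasSum_unique (fun s : ({0} : Set (Multiset ℕ)) ↦ q ^ s.1.sum)
  | succ k ih =>
    rw [Finset.prod_range_succ, ← mul_assoc]
    refine hasSum_pow_sum_of_split (2 * k + 1 + 1) (fun _ ↦ succ_notMem_of_mem_oddDistinct)
      (mem_oddDistinct_succ _) (hasSum_oddDistinct_odd ih) ?_
    have e : {c | Odd (2 * k + 1 + 1) → c ≤ 1} = Set.univ := by
      simp [Nat.odd_add_one]
    rw [e, ← (Equiv.Set.univ ℕ).symm.hasSum_iff]
    refine hasSum_geometric_of_norm_lt_one ?_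
    rw [norm_pow]
    exact pow_lt_one₀ (norm_nonneg _) hq (by simp)

theorem hasSum_oddDistinctEvenMax_fiber (hq : ‖q‖ < 1) (k : ℕ) :
    HasSum (fun s : {s | s ∈ oddDistinctEvenMax ∧ s.sup / 2 - 1 = k} ↦ q ^ s.1.sum)
      (q ^ (4 * (k + 1)) *
        ∏ i ∈ Finset.range (k + 1), (1 + q ^ (2 * i + 1)) * (1 - q ^ (2 * i + 2))⁻¹) := by
  have h : ‖q ^ (2 * k + 1 + 1)‖ < 1 := by
    rw [norm_pow]
    exact pow_lt_one₀ (norm_nonneg _) hq (by simp)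
  convert hasSum_pow_sum_of_split (2 * k + 1 + 1) (fun _ ↦ succ_notMem_of_mem_oddDistinct)
      (mem_oddDistinctEvenMax_iff k) (hasSum_oddDistinct_odd (hasSum_oddDistinct hq k))
      (hasSum_geometric_two_le h) using 1
  rw [Finset.prod_range_succ]
  ring

theorem one_sub_pow_ne_zero (hq : ‖q‖ < 1) {n : ℕ} (hn : n ≠ 0) : 1 - q ^ n ≠ 0 := fun h ↦ by
  have h' : ‖q ^ n‖ < 1 := by
    rw [norm_pow]
    exact pow_lt_one₀ (norm_nonneg _) hq hn
  rw [← sub_eq_zero.1 h, norm_one] at h'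
  exact h'.false

theorem prod_range_add_two (q : 𝕜) (K : ℕ) :
    (∏ i ∈ Finset.range (K + 2), (1 + q ^ (2 * i + 1)) * (1 - q ^ (2 * i + 2))⁻¹) =
      (1 + q) * (1 + q ^ 3) * (1 - q ^ 2)⁻¹ * (1 - q ^ (2 * K + 4))⁻¹ *
        ((∏ i ∈ Finset.range K, (1 + q ^ (2 * i + 5))) /
          ∏ i ∈ Finset.range K, (1 - q ^ (2 * i + 4))) := by
  induction K with
  | zero =>
    simp [Finset.prod_range_succ]
    ring
  | succ K ih =>
    rw [Finset.prod_range_succ, ih, Finset.prod_range_succ, Finset.prod_range_succ,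
      mul_div_mul_comm]
    ring

/-- The partial sums of the `q`-binomial series `∑ (-q; q²)ₖ / (q²; q²)ₖ q⁴ᵏ` in closed form. -/
theorem sum_range_qBinomial (hq : ‖q‖ < 1) (K : ℕ) :
    (∑ k ∈ Finset.range (K + 1), q ^ (4 * (k + 1)) *
      ∏ i ∈ Finset.range (k + 1), (1 + q ^ (2 * i + 1)) * (1 - q ^ (2 * i + 2))⁻¹) =
      (1 + (1 + q) * (1 - q ^ 2)⁻¹ * (q ^ 2) ^ (K + 2)) *
        ((∏ i ∈ Finset.range K, (1 + q ^ (2 * i + 5))) /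
          ∏ i ∈ Finset.range K, (1 - q ^ (2 * i + 4))) - 1 := by
  induction K with
  | zero =>
    simp
    ring
  | succ K ih =>
    rw [Finset.sum_range_succ, ih, prod_range_add_two q, Finset.prod_range_succ _ K,
      Finset.prod_range_succ _ K, mul_div_mul_comm]
    have h1 := one_sub_pow_ne_zero hq (n := 2) (by simp)
    have h2 := one_sub_pow_ne_zero hq (n := 2 * K + 4) (by simp)
    generalize (∏ i ∈ Finset.range K, (1 + q ^ (2 * i + 5))) /
          ∏ i ∈ Finset.range K, (1 - q ^ (2 * i + 4)) = R
    have e1 : q ^ (2 * K + 4) = q ^ 4 * (q ^ K) ^ 2 := by ring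
    have e2 : q ^ (2 * K + 5) = q ^ 5 * (q ^ K) ^ 2 := by ring
    have e3 : q ^ (4 * (K + 1 + 1)) = q ^ 8 * (q ^ K) ^ 4 := by ring
    have e4 : (q ^ 2) ^ (K + 2) = q ^ 4 * (q ^ K) ^ 2 := by ring
    have e5 : (q ^ 2) ^ (K + 1 + 2) = q ^ 6 * (q ^ K) ^ 2 := by ring
    rw [e1] at h2
    rw [e1, e2, e3, e4, e5]
    generalize q ^ K = y at *
    field_simp
    ring

theorem summable_norm_pow_mul_add (hq : ‖q‖ < 1) (b : ℕ) :
    Summable fun j : ℕ ↦ ‖q ^ (2 * j + b)‖ := by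
  have h2 : ‖q‖ ^ 2 < 1 := pow_lt_one₀ (norm_nonneg _) hq (by simp)
  simp_rw [norm_pow, pow_add, pow_mul]
  exact (summable_geometric_of_lt_one (by positivity) h2).mul_right (‖q‖ ^ b)

theorem tendsto_sum_qBinomial (hq : ‖q‖ < 1) :
    Tendsto (fun K ↦ ∑ k ∈ Finset.range K, q ^ (4 * (k + 1)) *
      ∏ i ∈ Finset.range (k + 1), (1 + q ^ (2 * i + 1)) * (1 - q ^ (2 * i + 2))⁻¹) atTop
      (𝓝 ((∏' j : ℕ, (1 + q ^ (2 * j + 5))) / (∏' j : ℕ, (1 - q ^ (2 * j + 4))) - 1)) := by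
  rw [← tendsto_add_atTop_iff_nat 1]
  simp_rw [sum_range_qBinomial hq]
  have s5 := summable_norm_pow_mul_add hq 5
  have s4 : Summable fun j : ℕ ↦ ‖-q ^ (2 * j + 4)‖ := by
    simpa only [norm_neg] using summable_norm_pow_mul_add hq 4
  have m5 := (multipliable_one_add_of_summable s5).hasProd.tendsto_prod_nat
  have m4 := (multipliable_one_add_of_summable s4).hasProd.tendsto_prod_nat
  have n4 := tprod_one_add_ne_zero_of_summable (f := fun j : ℕ ↦ -q ^ (2 * j + 4))
    (fun j ↦ by
      rw [← sub_eq_add_neg]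
      exact one_sub_pow_ne_zero hq (by simp)) s4
  simp only [← sub_eq_add_neg] at m4 n4
  have h2 : ‖q ^ 2‖ < 1 := by
    rw [norm_pow]
    exact pow_lt_one₀ (norm_nonneg _) hq (by simp)
  have hp := (tendsto_add_atTop_iff_nat 2).2 (tendsto_pow_atTop_nhds_zero_of_norm_lt_one h2)
  simpa using (((hp.const_mul ((1 + q) * (1 - q ^ 2)⁻¹)).const_add 1).mul
    (m5.div m4 n4)).sub_const 1

/-- The fibers of `s ↦ s.sup / 2 - 1` on `oddDistinctEvenMax`. -/
def sigmaSupEquiv :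
    (Σ k : ℕ, {s | s ∈ oddDistinctEvenMax ∧ s.sup / 2 - 1 = k}) ≃ oddDistinctEvenMax where
  toFun x := ⟨x.2.1, x.2.2.1⟩
  invFun s := ⟨_, s.1, s.2, rfl⟩
  left_inv := by
    rintro ⟨_, s, hs, rfl⟩
    rfl
  right_inv _ := rfl

theorem summable_oddDistinctEvenMax (hq : ‖q‖ < 1) :
    Summable fun s : oddDistinctEvenMax ↦ q ^ s.1.sum := by
  have hr : ‖‖q‖‖ < 1 := by rwa [norm_norm]
  have h := hasSum_oddDistinctEvenMax_fiber hr
  refine Summable.of_norm ?_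
  simp_rw [norm_pow]
  rw [← sigmaSupEquiv.summable_iff]
  refine (summable_sigma_of_nonneg fun x ↦ by simp only [Function.comp_apply]; positivity).2
    ⟨fun k ↦ (h k).summable, ?_⟩
  have ht : ∀ k, ∑' s : {s | s ∈ oddDistinctEvenMax ∧ s.sup / 2 - 1 = k}, ‖q‖ ^ s.1.sum = _ :=
    fun k ↦ (h k).tsum_eq
  change Summable fun k ↦
    ∑' s : {s | s ∈ oddDistinctEvenMax ∧ s.sup / 2 - 1 = k}, ‖q‖ ^ s.1.sum
  have hnn : ∀ k, 0 ≤ ∑' s : {s | s ∈ oddDistinctEvenMax ∧ s.sup / 2 - 1 = k}, ‖q‖ ^ s.1.sum :=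
    fun k ↦ tsum_nonneg fun s ↦ by positivity
  simp_rw [ht] at hnn ⊢
  exact ((hasSum_iff_tendsto_nat_of_nonneg hnn _).2 (tendsto_sum_qBinomial hr)).summable

theorem hasSum_oddDistinctEvenMax (hq : ‖q‖ < 1) :
    HasSum (fun s : oddDistinctEvenMax ↦ q ^ s.1.sum)
      ((∏' j : ℕ, (1 + q ^ (2 * j + 5))) / (∏' j : ℕ, (1 - q ^ (2 * j + 4))) - 1) := by
  have hs := (summable_oddDistinctEvenMax hq).hasSum
  have h := (sigmaSupEquiv.hasSum_iff.2 hs).sigma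
    (hasSum_oddDistinctEvenMax_fiber hq)
  rwa [tendsto_nhds_unique h.tendsto_sum_nat (tendsto_sum_qBinomial hq)] at hs

/-- Partitions counted by `o2`, for all `n` at once, as multisets. -/
def sigmaPartitionEquiv :
    (Σ n : ℕ, {p : n.Partition //
      (∀ a : ℕ, Odd a → p.parts.count a ≤ 1) ∧ Even p.parts.sup ∧
        2 ≤ p.parts.count p.parts.sup}) ≃ oddDistinctEvenMax where
  toFun x := ⟨x.2.1.parts, fun _ ↦ x.2.1.parts_pos, x.2.2⟩
  invFun s := ⟨s.1.sum, ⟨s.1, fun {a} ↦ s.2.1 a, rfl⟩, s.2.2⟩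
  left_inv := by
    rintro ⟨_, ⟨s, hs, rfl⟩, h⟩
    rfl
  right_inv _ := rfl

theorem hasSum_o2 (hq : ‖q‖ < 1) :
    HasSum (fun n : ℕ ↦ (o2 n : 𝕜) * q ^ n)
      ((∏' j : ℕ, (1 + q ^ (2 * j + 5))) / (∏' j : ℕ, (1 - q ^ (2 * j + 4))) - 1) := by
  refine (sigmaPartitionEquiv.hasSum_iff.2 (hasSum_oddDistinctEvenMax hq)).sigma fun n ↦ ?_
  classical
  have e : (o2 n : 𝕜) * q ^ n = ∑ p : {p : n.Partition //
      (∀ a : ℕ, Odd a → p.parts.count a ≤ 1) ∧ Even p.parts.sup ∧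
        2 ≤ p.parts.count p.parts.sup}, q ^ p.1.parts.sum := by
    simp only [Nat.Partition.parts_sum, Finset.sum_const, Finset.card_univ, nsmul_eq_mul, o2,
      Nat.card_eq_fintype_card]
  rw [e]
  exact hasSum_fintype _

end Multiset

theorem o2_generating_function (q : ℂ) (hq : ‖q‖ < 1) :
    Summable (fun n : ℕ => ‖(o2 n : ℂ) * q ^ n‖) ∧
    ∑' n : ℕ, (o2 n : ℂ) * q ^ n =
      (∏' j : ℕ, (1 + q ^ (2 * j + 5))) / (∏' j : ℕ, (1 - q ^ (2 * j + 4))) - 1 := by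
  have h := Multiset.hasSum_o2 hq
  exact ⟨h.summable.norm, h.tsum_eq⟩
end

section
/- For every complex number q with |q| < 1, the series \sum_{n=0}^{\infty} pod_{>2}(n) q^n converges absolutely and equals (-q^3; q^2)_{\infty} / (q^4; q^2)_{\infty}, i.e. \prod_{j=0}^{\infty} (1 + q^{2j+3}) / \prod_{j=0}^{\infty} (1 - q^{2j+4}). -/
open PowerSeries Finset Filter
open scoped PowerSeries.WithPiTopology Topology

section Evaluation

variable {K : Type*} [NormedField K]

/-- The power series `p` converges absolutely at `x`, with sum `v`. -/
def AbsHasEval (p : ℕ⟦X⟧) (x v : K) : Prop :=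
  Summable (fun n ↦ ‖((coeff n p : ℕ) : K) * x ^ n‖) ∧ HasSum (fun n ↦ ((coeff n p : ℕ) : K) * x ^ n) v

theorem absHasEval_one (x : K) : AbsHasEval 1 x 1 := by
  have h (n : ℕ) (hn : n ≠ 0) : ((coeff n (1 : ℕ⟦X⟧) : ℕ) : K) * x ^ n = 0 := by
    simp [coeff_one, hn]
  refine ⟨summable_of_ne_finset_zero (s := {0}) fun n hn ↦ by rw [h n (by simpa using hn), norm_zero], ?_⟩
  convert hasSum_single 0 h
  simp

theorem absHasEval_one_add_X_pow (x : K) {m : ℕ} (hm : m ≠ 0) :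
    AbsHasEval (1 + X ^ m) x (1 + x ^ m) := by
  have h (n : ℕ) (hn : n ∉ ({0, m} : Finset ℕ)) :
      ((coeff n (1 + X ^ m : ℕ⟦X⟧) : ℕ) : K) * x ^ n = 0 := by
    simp only [Finset.mem_insert, Finset.mem_singleton, not_or] at hn
    simp [coeff_one, coeff_X_pow, hn]
  refine ⟨summable_of_ne_finset_zero (s := {0, m}) fun n hn ↦ by rw [h n hn, norm_zero], ?_⟩
  have hsum := hasSum_sum_of_ne_finset_zero (L := .unconditional ℕ) h
  rw [Finset.sum_pair hm.symm] at hsum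
  simpa [coeff_one, coeff_X_pow, hm, hm.symm] using hsum

theorem absHasEval_geometric {x : K} (hx : ‖x‖ < 1) {m : ℕ} (hm : m ≠ 0) :
    AbsHasEval (PowerSeries.mk fun n ↦ if m ∣ n then 1 else 0) x (1 - x ^ m)⁻¹ := by
  constructor
  · refine (summable_geometric_of_lt_one (norm_nonneg x) hx).of_nonneg_of_le
      (fun _ ↦ norm_nonneg _) fun n ↦ ?_
    by_cases h : m ∣ n <;> simp [h]
  · have hinj : Function.Injective (m * · : ℕ → ℕ) := mul_right_injective₀ hm
    rw [← hinj.hasSum_iff]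
    · simpa [Function.comp_def, pow_mul] using
        hasSum_geometric_of_norm_lt_one (ξ := x ^ m)
          (by simpa using pow_lt_one₀ (norm_nonneg x) hx hm)
    · intro n hn
      have : ¬ m ∣ n := fun ⟨k, hk⟩ ↦ hn ⟨k, hk.symm⟩
      simp [this]

theorem AbsHasEval.mul [CompleteSpace K] {p r : ℕ⟦X⟧} {x v w : K}
    (hp : AbsHasEval p x v) (hr : AbsHasEval r x w) : AbsHasEval (p * r) x (v * w) := by
  have key (n : ℕ) : ((coeff n (p * r) : ℕ) : K) * x ^ n = ∑ kl ∈ antidiagonal n,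
      ((coeff kl.1 p : ℕ) : K) * x ^ kl.1 * (((coeff kl.2 r : ℕ) : K) * x ^ kl.2) := by
    rw [coeff_mul, Nat.cast_sum, Finset.sum_mul]
    refine Finset.sum_congr rfl fun kl hkl ↦ ?_
    rw [← mem_antidiagonal.mp hkl]
    push_cast
    ring
  have hs := summable_norm_sum_mul_antidiagonal_of_summable_norm hp.1 hr.1
  simp only [AbsHasEval, key]
  refine ⟨hs, ?_⟩
  rw [← hp.2.tsum_eq, ← hr.2.tsum_eq,
    tsum_mul_tsum_eq_tsum_sum_antidiagonal_of_summable_norm hp.1 hr.1]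
  exact hs.of_norm.hasSum

theorem AbsHasEval.prod [CompleteSpace K] {ι : Type*} (s : Finset ι) {g : ι → ℕ⟦X⟧} {x : K}
    {v : ι → K} (h : ∀ i, AbsHasEval (g i) x (v i)) :
    AbsHasEval (∏ i ∈ s, g i) x (∏ i ∈ s, v i) := by
  classical
  induction s using Finset.induction_on with
  | empty => simpa using absHasEval_one x
  | insert a s ha ih => simpa [Finset.prod_insert ha] using (h a).mul ih

end Evaluation

/-- A formal infinite product with natural coefficients and constant coefficients `1` may be
evaluated at `q` factor by factor, provided the product of the values at `‖q‖` converges. -/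
theorem AbsHasEval.of_hasProd {g : ℕ → ℕ⟦X⟧} {G : ℕ⟦X⟧} (hG : HasProd g G)
    (hg : ∀ i, constantCoeff (g i) = 1) {q : ℂ} {u : ℕ → ℝ} {v : ℕ → ℂ}
    (hu : ∀ i, AbsHasEval (g i) ‖q‖ (u i)) (hv : ∀ i, AbsHasEval (g i) q (v i))
    (hmu : Multipliable u) (hmv : Multipliable v) : AbsHasEval G q (∏' i, v i) := by
  set P : ℕ → ℕ⟦X⟧ := fun N ↦ ∏ i ∈ Finset.range N, g i
  have hlim (n : ℕ) : Tendsto (fun N ↦ coeff n (P N)) atTop (𝓝 (coeff n G)) :=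
    ((WithPiTopology.continuous_coeff ℕ n).tendsto G).comp hG.tendsto_prod_nat
  have hmono (n : ℕ) : Monotone fun N ↦ coeff n (P N) := by
    refine monotone_nat_of_le_succ fun N ↦ ?_
    simp only [P, Finset.prod_range_succ, coeff_mul]
    refine le_trans ?_ (Finset.single_le_sum (fun _ _ ↦ Nat.zero_le _)
      (HasAntidiagonal.mem_antidiagonal (a := (n, 0)).mpr (add_zero n)))
    simp [hg]
  have hle (n N : ℕ) : coeff n (P N) ≤ coeff n G := (hmono n).ge_of_tendsto (hlim n) N
  obtain ⟨C, hC⟩ := hmu.hasProd.tendsto_prod_nat.bddAbove_range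
  have hpartial (s : Finset ℕ) : ∑ n ∈ s, ((coeff n G : ℕ) : ℝ) * ‖q‖ ^ n ≤ C := by
    have ht : Tendsto (fun N ↦ ∑ n ∈ s, ((coeff n (P N) : ℕ) : ℝ) * ‖q‖ ^ n) atTop
        (𝓝 (∑ n ∈ s, ((coeff n G : ℕ) : ℝ) * ‖q‖ ^ n)) :=
      tendsto_finsetSum s fun n _ ↦
        ((continuous_of_discreteTopology.tendsto _).comp (hlim n)).mul_const _
    refine le_of_tendsto' ht fun N ↦ ?_
    refine (sum_le_hasSum s (fun n _ ↦ by positivity) (AbsHasEval.prod _ hu).2).trans ?_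
    exact hC ⟨N, rfl⟩
  have hsum : Summable fun n ↦ ((coeff n G : ℕ) : ℝ) * ‖q‖ ^ n :=
    summable_of_sum_le (fun n ↦ by positivity) hpartial
  have hnorm : Summable fun n ↦ ‖((coeff n G : ℕ) : ℂ) * q ^ n‖ := by simpa using hsum
  refine ⟨hnorm, ?_⟩
  have ht := tendsto_tsum_of_dominated_convergence (𝓕 := atTop)
    (f := fun N n ↦ ((coeff n (P N) : ℕ) : ℂ) * q ^ n)
    (g := fun n ↦ ((coeff n G : ℕ) : ℂ) * q ^ n) hsum
    (fun n ↦ ((continuous_of_discreteTopology.tendsto _).comp (hlim n)).mul_const _)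
    (Eventually.of_forall fun N n ↦ by
      simp only [norm_mul, Complex.norm_natCast, norm_pow]
      gcongr
      exact hle n N)
  simp only [P, (AbsHasEval.prod _ hv).2.tsum_eq] at ht
  rw [← tendsto_nhds_unique ht hmv.hasProd.tendsto_prod_nat]
  exact hnorm.of_norm.hasSum

/-- The indicator that the part `i` is allowed to occur `c` times. -/
def podGT2Weight (i c : ℕ) : ℕ := if 2 < i ∧ (Odd i → c ≤ 1) then 1 else 0

theorem coeff_genFun_podGT2Weight (n : ℕ) :
    coeff n (Nat.Partition.genFun podGT2Weight) = podGT2 n := by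
  classical
  rw [Nat.Partition.coeff_genFun, podGT2, Nat.card_eq_fintype_card, Fintype.card_subtype,
    Finset.card_filter]
  refine Finset.sum_congr rfl fun p _ ↦ ?_
  simp only [Finsupp.prod, Multiset.toFinsupp_support, Multiset.toFinsupp_apply]
  split_ifs with h
  · exact Finset.prod_eq_one fun a ha ↦
      if_pos ⟨h.2 a (Multiset.mem_toFinset.mp ha), h.1 a⟩
  · contrapose! h
    have hw (a : ℕ) (ha : a ∈ p.parts) : 2 < a ∧ (Odd a → p.parts.count a ≤ 1) := by
      by_contra hn
      exact Finset.prod_ne_zero_iff.mp h a (Multiset.mem_toFinset.mpr ha) (if_neg hn)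
    refine ⟨fun a ha ↦ ?_, fun a ha ↦ (hw a ha).1⟩
    by_cases hm : a ∈ p.parts
    · exact (hw a hm).2 ha
    · simp [Multiset.count_eq_zero_of_notMem hm]

/-- The contribution of the part `i + 1` to the generating function. -/
noncomputable def podGT2Factor (i : ℕ) : ℕ⟦X⟧ :=
  if i < 2 then 1 else if Even i then 1 + X ^ (i + 1)
  else PowerSeries.mk fun n ↦ if i + 1 ∣ n then 1 else 0

theorem one_add_tsum_podGT2Weight (i : ℕ) :
    (1 + ∑' j, C (podGT2Weight (i + 1) (j + 1)) * X ^ ((i + 1) * (j + 1)) : ℕ⟦X⟧) =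
      podGT2Factor i := by
  unfold podGT2Factor
  split_ifs with h2 he
  · have (j : ℕ) : podGT2Weight (i + 1) (j + 1) = 0 := if_neg fun h ↦ by omega
    simp [this]
  · rw [tsum_eq_single 0]
    · have : podGT2Weight (i + 1) (0 + 1) = 1 := if_pos ⟨by omega, fun _ ↦ by omega⟩
      simp [this]
    · intro j hj
      have : podGT2Weight (i + 1) (j + 1) = 0 :=
        if_neg fun h ↦ by have := h.2 he.add_one; omega
      simp [this]
  · have hw (j : ℕ) : podGT2Weight (i + 1) (j + 1) = 1 :=
      if_pos ⟨by omega, fun h ↦ absurd h (by grind)⟩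
    ext n
    have hs := Nat.Partition.summable_genFun_term podGT2Weight i
    simp only [smul_eq_C_mul] at hs
    rw [map_add, hs.map_tsum _ (WithPiTopology.continuous_coeff _ _)]
    simp only [hw, map_one, one_mul, coeff_X_pow, coeff_mk, coeff_one]
    split_ifs with h0 hd hd
    · subst h0
      simp
    · simp [h0] at hd
    · obtain ⟨k, rfl⟩ := hd
      obtain ⟨k, rfl⟩ := Nat.exists_eq_add_one_of_ne_zero (right_ne_zero_of_mul h0)
      rw [tsum_eq_single k]
      · simp
      · intro j hj
        refine if_neg fun h ↦ hj ?_
        have := Nat.eq_of_mul_eq_mul_left i.succ_pos h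
        omega
    · have (j : ℕ) : n ≠ (i + 1) * (j + 1) := fun h ↦ hd ⟨_, h⟩
      simp [this]

theorem hasProd_podGT2Factor :
    HasProd podGT2Factor (Nat.Partition.genFun podGT2Weight) := by
  simpa only [smul_eq_C_mul, one_add_tsum_podGT2Weight] using Nat.Partition.hasProd_genFun podGT2Weight

theorem constantCoeff_podGT2Factor (i : ℕ) : constantCoeff (podGT2Factor i) = 1 := by
  unfold podGT2Factor
  split_ifs <;> simp [← coeff_zero_eq_constantCoeff_apply, -coeff_zero_eq_constantCoeff, coeff_X_pow]

section Values

variable {K : Type*} [NormedField K]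

/-- The value of `podGT2Factor i` at `x`. -/
noncomputable def podGT2Value (x : K) (i : ℕ) : K :=
  if i < 2 then 1 else if Even i then 1 + x ^ (i + 1) else (1 - x ^ (i + 1))⁻¹

theorem absHasEval_podGT2Factor {x : K} (hx : ‖x‖ < 1) (i : ℕ) :
    AbsHasEval (podGT2Factor i) x (podGT2Value x i) := by
  unfold podGT2Factor podGT2Value
  split_ifs
  · exact absHasEval_one x
  · exact absHasEval_one_add_X_pow x i.succ_ne_zero
  · exact absHasEval_geometric hx i.succ_ne_zero

theorem one_sub_pow_ne_zero {x : K} (hx : ‖x‖ < 1) {m : ℕ} (hm : m ≠ 0) : 1 - x ^ m ≠ 0 := by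
  intro h
  have := pow_lt_one₀ (norm_nonneg x) hx hm
  rw [← norm_pow, ← sub_eq_zero.mp h, norm_one] at this
  exact this.false

theorem norm_inv_one_sub_pow_sub_one_le {x : K} (hx : ‖x‖ < 1) {m : ℕ} (hm : m ≠ 0) :
    ‖(1 - x ^ m)⁻¹ - 1‖ ≤ ‖x‖ ^ m / (1 - ‖x‖) := by
  have hne := one_sub_pow_ne_zero hx hm
  have h : (1 - x ^ m)⁻¹ - 1 = x ^ m / (1 - x ^ m) := by field_simp; ring
  rw [h, norm_div, norm_pow]
  have h1 : 1 - ‖x‖ ≤ ‖1 - x ^ m‖ := by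
    have := norm_sub_norm_le (1 : K) (x ^ m)
    rw [norm_one, norm_pow] at this
    linarith [pow_le_of_le_one (norm_nonneg x) hx.le hm]
  have : 0 < 1 - ‖x‖ := sub_pos.mpr hx
  gcongr

theorem multipliable_podGT2Value [CompleteSpace K] {x : K} (hx : ‖x‖ < 1) :
    Multipliable (podGT2Value x) := by
  have h1 : 0 < 1 - ‖x‖ := sub_pos.mpr hx
  have hs : Summable fun i ↦ ‖podGT2Value x i - 1‖ := by
    refine (((summable_nat_add_iff 1).mpr
      (summable_geometric_of_lt_one (norm_nonneg x) hx)).div_const (1 - ‖x‖)).of_nonneg_of_le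
      (fun _ ↦ norm_nonneg _) fun i ↦ ?_
    unfold podGT2Value
    split_ifs
    · simp only [sub_self, norm_zero]
      positivity
    · rw [add_sub_cancel_left, norm_pow]
      exact le_div_self (by positivity) h1 (by linarith [norm_nonneg x])
    · exact norm_inv_one_sub_pow_sub_one_le hx i.succ_ne_zero
  simpa using multipliable_one_add_of_summable hs

theorem tprod_podGT2Value [CompleteSpace K] {x : K} (hx : ‖x‖ < 1) :
    ∏' i, podGT2Value x i =
      (∏' j : ℕ, (1 + x ^ (2 * j + 3))) / ∏' j : ℕ, (1 - x ^ (2 * j + 4)) := by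
  have hgeom (m : ℕ) : Summable fun j : ℕ ↦ ‖x‖ ^ (2 * j + m) :=
    (summable_geometric_of_lt_one (norm_nonneg x) hx).comp_injective
      (i := fun j : ℕ ↦ 2 * j + m) fun a b h ↦ by simpa using h
  have hodd : Multipliable fun j : ℕ ↦ 1 + x ^ (2 * j + 3) :=
    multipliable_one_add_of_summable (by simpa using hgeom 3)
  have heven : Multipliable fun j : ℕ ↦ 1 - x ^ (2 * j + 4) := by
    simpa [sub_eq_add_neg] using
      multipliable_one_add_of_summable (f := fun j : ℕ ↦ -x ^ (2 * j + 4)) (by simpa using hgeom 4)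
  have hinv : Multipliable fun j : ℕ ↦ (1 - x ^ (2 * j + 4))⁻¹ := by
    have : Summable fun j : ℕ ↦ ‖(1 - x ^ (2 * j + 4))⁻¹ - 1‖ :=
      ((hgeom 4).div_const (1 - ‖x‖)).of_nonneg_of_le (fun _ ↦ norm_nonneg _)
        fun j ↦ norm_inv_one_sub_pow_sub_one_le hx (Nat.succ_ne_zero _)
    simpa using multipliable_one_add_of_summable this
  have hmul : (∏' j : ℕ, (1 - x ^ (2 * j + 4))⁻¹) * ∏' j : ℕ, (1 - x ^ (2 * j + 4)) = 1 := by
    rw [← hinv.tprod_mul heven]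
    exact (tprod_congr fun j ↦
      inv_mul_cancel₀ (one_sub_pow_ne_zero hx (Nat.succ_ne_zero _))).trans tprod_one
  have he (j : ℕ) : podGT2Value x (2 * j + 2) = 1 + x ^ (2 * j + 3) := by
    rw [podGT2Value, if_neg (by omega), if_pos (by grind)]
  have ho (j : ℕ) : podGT2Value x (2 * j + 1 + 2) = (1 - x ^ (2 * j + 4))⁻¹ := by
    rw [podGT2Value, if_neg (by omega), if_neg (by grind)]
  have hshift : ∏' i, podGT2Value x (i + 2) = ∏' i, podGT2Value x i := by
    rw [eq_comm]
    refine HasProd.tprod_eq ?_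
    have hm : Multipliable fun i ↦ podGT2Value x (i + 2) := by
      rw [← funext he] at hodd
      rw [← funext ho] at hinv
      exact hodd.even_mul_odd (f := fun i ↦ podGT2Value x (i + 2)) hinv
    have hp := hm.hasProd.prod_range_mul
    simpa [Finset.prod_range_succ, podGT2Value] using hp
  rw [← hshift, ← tprod_even_mul_odd (f := fun i ↦ podGT2Value x (i + 2))
    (by simpa only [he] using hodd) (by simpa only [ho] using hinv)]
  simp only [he, ho]
  rw [eq_div_iff (right_ne_zero_of_mul_eq_one hmul), mul_assoc, hmul, mul_one]

end Values

theorem podGT2_generating_function (q : ℂ) (hq : ‖q‖ < 1) :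
    Summable (fun n : ℕ => ‖(podGT2 n : ℂ) * q ^ n‖) ∧
    ∑' n : ℕ, (podGT2 n : ℂ) * q ^ n =
      (∏' j : ℕ, (1 + q ^ (2 * j + 3))) / ∏' j : ℕ, (1 - q ^ (2 * j + 4)) := by
  have h := AbsHasEval.of_hasProd hasProd_podGT2Factor constantCoeff_podGT2Factor
    (absHasEval_podGT2Factor (x := ‖q‖) (by simpa using hq)) (absHasEval_podGT2Factor hq)
    (multipliable_podGT2Value (by simpa using hq)) (multipliable_podGT2Value hq)
  simp only [AbsHasEval, coeff_genFun_podGT2Weight, tprod_podGT2Value hq] at h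
  exact ⟨h.1, h.2.tsum_eq⟩
end

section
/- For every complex number q with |q| < 1, the series \sum_{n=0}^{\infty} o3(n) q^n converges absolutely and equals 1 + \sum_{n=1}^{\infty} (-q; q^2)_n q^{2n} / (q^2; q^2)_{n-1}, i.e. 1 + \sum_{n=1}^{\infty} \left( \prod_{j=0}^{n-1} (1 + q^{2j+1}) \right) q^{2n} / \prod_{j=0}^{n-2} (1 - q^{2j+2}). -/
/-- `o3 n` is the number of partitions of `n` in which every odd part
appears at most once, the largest part is even, and the largest part
appears exactly once; `o3 0 = 1` (the empty partition is counted). -/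
noncomputable def o3 (n : ℕ) : ℕ :=
  Nat.card {p : n.Partition //
    (∀ a : ℕ, Odd a → p.parts.count a ≤ 1) ∧ Even p.parts.sup ∧
      (p.parts = 0 ∨ p.parts.count p.parts.sup = 1)}

/-- Multisets of integers in `[1, n]` in which every odd element appears at most once. -/
def oddSimpleMultisets (n : ℕ) : Set (Multiset ℕ) :=
  {m | (∀ a ∈ m, 0 < a ∧ a ≤ n) ∧ ∀ a, Odd a → m.count a ≤ 1}

/-- The multisets of parts of the partitions counted by `o3`. -/
def o3Multisets : Set (Multiset ℕ) :=
  {m | (∀ a ∈ m, 0 < a) ∧ (∀ a, Odd a → m.count a ≤ 1) ∧ Even m.sup ∧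
    (m = 0 ∨ m.count m.sup = 1)}

lemma add_replicate_mem_oddSimpleMultisets {n k : ℕ} {m : Multiset ℕ}
    (hm : m ∈ oddSimpleMultisets n) (hk : Odd (n + 1) → k ≤ 1) :
    m + Multiset.replicate k (n + 1) ∈ oddSimpleMultisets (n + 1) := by
  refine ⟨fun a ha => ?_, fun a ha => ?_⟩
  · rcases Multiset.mem_add.1 ha with h | h
    · have := hm.1 a h
      omega
    · have := Multiset.eq_of_mem_replicate h
      omega
  · rw [Multiset.count_add, Multiset.count_replicate]
    split_ifs with h
    · subst h
      rw [Multiset.count_eq_zero_of_notMem fun h => by have := hm.1 _ h; omega]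
      simpa using hk ha
    · simpa using hm.2 a ha

/-- Splitting off the copies of the largest allowed element. -/
noncomputable def oddSimpleMultisetsSuccEquiv (n : ℕ) :
    oddSimpleMultisets n × {k : ℕ | Odd (n + 1) → k ≤ 1} ≃ oddSimpleMultisets (n + 1) :=
  Equiv.ofBijective
    (fun p => ⟨p.1 + Multiset.replicate p.2 (n + 1),
      add_replicate_mem_oddSimpleMultisets p.1.2 p.2.2⟩) <| by
    have hcount : ∀ m ∈ oddSimpleMultisets n, m.count (n + 1) = 0 := fun m hm =>
      Multiset.count_eq_zero_of_notMem fun h => by have := hm.1 _ h; omega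
    constructor
    · rintro ⟨⟨m, hm⟩, k, hk⟩ ⟨⟨m', hm'⟩, k', hk'⟩ h
      have h : m + Multiset.replicate k (n + 1) = m' + Multiset.replicate k' (n + 1) :=
        congrArg Subtype.val h
      have hkk : k = k' := by
        simpa [hcount m hm, hcount m' hm'] using congrArg (Multiset.count (n + 1)) h
      subst hkk
      simpa using h
    · rintro ⟨m, hm⟩
      refine ⟨⟨⟨m.filter (· ≠ n + 1), fun a ha => ?_, fun a ha => ?_⟩,
        m.count (n + 1), hm.2 (n + 1)⟩, Subtype.ext ?_⟩
      · obtain ⟨h, hne⟩ := Multiset.mem_filter.1 ha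
        have := hm.1 a h
        omega
      · exact (Multiset.count_le_of_le a (Multiset.filter_le _ m)).trans (hm.2 a ha)
      · ext a
        by_cases h : a = n + 1
        · simp [h]
        · simp [h, Multiset.count_replicate, Ne.symm h]

/-- The contribution of the part `i` to the generating function. -/
noncomputable def oddSimpleFactor (q : ℂ) (i : ℕ) : ℂ :=
  if Odd i then 1 + q ^ i else (1 - q ^ i)⁻¹

lemma hasSum_pow_part {q : ℂ} (hq : ‖q‖ < 1) (n : ℕ) :
    HasSum (fun k : {k : ℕ | Odd (n + 1) → k ≤ 1} => q ^ ((n + 1) * (k : ℕ)))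
      (oddSimpleFactor q (n + 1)) := by
  have hpow : ‖q ^ (n + 1)‖ < 1 := by
    rw [norm_pow]
    exact pow_lt_one₀ (norm_nonneg q) hq n.succ_ne_zero
  rw [show (fun k : {k : ℕ | Odd (n + 1) → k ≤ 1} => q ^ ((n + 1) * (k : ℕ))) =
    (fun k : ℕ => q ^ ((n + 1) * k)) ∘ Subtype.val from rfl, hasSum_subtype_iff_indicator,
    oddSimpleFactor]
  split_ifs with h
  · have hsum := hasSum_sum_of_ne_finset_zero (s := Finset.range 2)
      (L := SummationFilter.unconditional ℕ)
      (f := {k : ℕ | Odd (n + 1) → k ≤ 1}.indicator fun k : ℕ => q ^ ((n + 1) * k))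
      (fun k hk => Set.indicator_of_notMem (by simp at hk ⊢; exact ⟨h, by omega⟩) _)
    convert hsum using 1
    simp [Finset.sum_range_succ, Set.indicator]
  · simpa [h, pow_mul] using hasSum_geometric_of_norm_lt_one hpow

lemma hasSum_pow_sum_oddSimpleMultisets {q : ℂ} (hq : ‖q‖ < 1) (n : ℕ) :
    HasSum (fun m : oddSimpleMultisets n => q ^ (m : Multiset ℕ).sum)
      (∏ i ∈ Finset.range n, oddSimpleFactor q (i + 1)) := by
  induction n with
  | zero =>
    have h0 : (0 : Multiset ℕ) ∈ oddSimpleMultisets 0 := ⟨by simp, by simp⟩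
    have : ∀ m : oddSimpleMultisets 0, m = ⟨0, h0⟩ := fun m => Subtype.ext <|
      Multiset.eq_zero_of_forall_notMem fun a ha => by have := m.2.1 a ha; omega
    simpa using hasSum_single (f := fun m : oddSimpleMultisets 0 => q ^ (m : Multiset ℕ).sum)
      ⟨0, h0⟩ fun m hm => (hm (this m)).elim
  | succ n ih =>
    have hpart := hasSum_pow_part hq n
    rw [Finset.prod_range_succ, ← (oddSimpleMultisetsSuccEquiv n).hasSum_iff]
    have hsummable := summable_mul_of_summable_norm
      (f := fun m : oddSimpleMultisets n => q ^ (m : Multiset ℕ).sum)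
      (g := fun k : {k : ℕ | Odd (n + 1) → k ≤ 1} => q ^ ((n + 1) * (k : ℕ)))
      ih.summable.norm hpart.summable.norm
    refine (ih.mul hpart hsummable).congr_fun fun p => ?_
    change q ^ ((p.1 : Multiset ℕ) + Multiset.replicate p.2 (n + 1)).sum = _
    simp [pow_add, mul_comm]

lemma prod_oddSimpleFactor (q : ℂ) (n : ℕ) :
    ∏ i ∈ Finset.range (2 * n + 1), oddSimpleFactor q (i + 1) =
      (∏ j ∈ Finset.range (n + 1), (1 + q ^ (2 * j + 1))) /
        ∏ j ∈ Finset.range n, (1 - q ^ (2 * j + 2)) := by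
  induction n with
  | zero => simp [oddSimpleFactor]
  | succ n ih =>
    have hodd : Odd (2 * n + 1 + 1 + 1) := ⟨n + 1, by ring⟩
    have heven : ¬ Odd (2 * n + 1 + 1) := by simp [parity_simps]
    rw [show 2 * (n + 1) + 1 = 2 * n + 1 + 1 + 1 by ring, Finset.prod_range_succ,
      Finset.prod_range_succ, ih, Finset.prod_range_succ _ (n + 1), Finset.prod_range_succ _ n,
      Finset.prod_range_succ _ n, oddSimpleFactor, oddSimpleFactor, if_neg heven, if_pos hodd]
    simp only [div_eq_mul_inv, mul_inv]
    ring

lemma sup_cons_of_mem_oddSimpleMultisets {n : ℕ} {m : Multiset ℕ}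
    (hm : m ∈ oddSimpleMultisets (2 * n + 1)) : ((2 * n + 2) ::ₘ m).sup = 2 * n + 2 := by
  rw [Multiset.sup_cons, sup_eq_left]
  exact Multiset.sup_le.2 fun a ha => (hm.1 a ha).2.trans (by omega)

lemma cons_mem_o3Multisets {n : ℕ} {m : Multiset ℕ}
    (hm : m ∈ oddSimpleMultisets (2 * n + 1)) : (2 * n + 2) ::ₘ m ∈ o3Multisets := by
  refine ⟨fun a ha => ?_, fun a ha => ?_, ?_, Or.inr ?_⟩
  · rcases Multiset.mem_cons.1 ha with h | h
    · omega
    · exact (hm.1 a h).1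
  · rw [Multiset.count_cons_of_ne]
    · exact hm.2 a ha
    · rintro rfl
      exact Nat.not_odd_iff_even.2 ⟨n + 1, by ring⟩ ha
  · rw [sup_cons_of_mem_oddSimpleMultisets hm]
    simp [parity_simps]
  · rw [sup_cons_of_mem_oddSimpleMultisets hm, Multiset.count_cons_self,
      Multiset.count_eq_zero_of_notMem fun h => by have := hm.1 _ h; omega]

/-- Removing the largest part of a partition counted by `o3`. -/
noncomputable def o3MultisetsEquiv :
    Option (Σ n : ℕ, oddSimpleMultisets (2 * n + 1)) ≃ o3Multisets :=
  Equiv.ofBijective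
    (fun o => o.elim ⟨0, by simp [o3Multisets]⟩
      fun p => ⟨(2 * p.1 + 2) ::ₘ p.2, cons_mem_o3Multisets p.2.2⟩) <| by
    constructor
    · rintro (_ | ⟨n, m, hm⟩) (_ | ⟨n', m', hm'⟩) h
      · rfl
      · exact (Multiset.cons_ne_zero (congrArg Subtype.val h).symm).elim
      · exact (Multiset.cons_ne_zero (congrArg Subtype.val h)).elim
      · have h : (2 * n + 2) ::ₘ m = (2 * n' + 2) ::ₘ m' := congrArg Subtype.val h
        obtain rfl : n = n' := by
          have := congrArg Multiset.sup h
          rw [sup_cons_of_mem_oddSimpleMultisets hm, sup_cons_of_mem_oddSimpleMultisets hm'] at this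
          omega
        obtain rfl := (Multiset.cons_inj_right _).1 h
        rfl
    · rintro ⟨m, hpos, hodd, heven, hsup⟩
      rcases eq_or_ne m 0 with rfl | hm
      · exact ⟨none, rfl⟩
      replace hsup := hsup.resolve_left hm
      have hmem : m.sup ∈ m := Multiset.count_pos.1 (by omega)
      obtain ⟨n, hn⟩ : ∃ n, m.sup = 2 * n + 2 := by
        obtain ⟨k, hk⟩ := heven
        have := hpos _ hmem
        exact ⟨k - 1, by omega⟩
      have hle : ∀ a ∈ m, a ≤ 2 * n + 2 := fun a ha => hn ▸ Multiset.le_sup ha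
      rw [hn] at hsup hmem
      obtain ⟨t, rfl⟩ := Multiset.exists_cons_of_mem hmem
      have hnot : 2 * n + 2 ∉ t := by simpa using hsup
      refine ⟨some ⟨n, t, fun a ha => ?_, fun a ha => ?_⟩, rfl⟩
      · have hat := Multiset.mem_cons_of_mem (b := 2 * n + 2) ha
        have h1 := hle a hat
        have h2 : a ≠ 2 * n + 2 := ne_of_mem_of_not_mem ha hnot
        exact ⟨hpos a hat, by omega⟩
      · exact (Multiset.count_le_count_cons _ _ _).trans (hodd a ha)

lemma o3_eq_card_fiber (n : ℕ) :
    o3 n = Nat.card {m : o3Multisets // (m : Multiset ℕ).sum = n} :=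
  Nat.card_congr
    { toFun p := ⟨⟨p.1.parts, fun _ h => p.1.parts_pos h, p.2⟩, p.1.parts_sum⟩
      invFun m := ⟨⟨m.1.1, fun h => m.1.2.1 _ h, m.2⟩, m.1.2.2⟩
      left_inv _ := rfl
      right_inv _ := rfl }

instance (n : ℕ) : Finite {m : o3Multisets // (m : Multiset ℕ).sum = n} :=
  Finite.of_injective
    (fun m => (⟨m.1.1, fun h => m.1.2.1 _ h, m.2⟩ : n.Partition)) fun _ _ h =>
      Subtype.ext <| Subtype.ext <| congrArg Nat.Partition.parts h

lemma hasSum_o3_mul_pow {𝕜 : Type*} [NormedField 𝕜] {x s : 𝕜}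
    (h : HasSum (fun m : o3Multisets => x ^ (m : Multiset ℕ).sum) s) :
    HasSum (fun n : ℕ => (o3 n : 𝕜) * x ^ n) s := by
  refine HasSum.sigma ((Equiv.sigmaFiberEquiv
    fun m : o3Multisets => (m : Multiset ℕ).sum).hasSum_iff.2 h) fun n => ?_
  have := Fintype.ofFinite {m : o3Multisets // (m : Multiset ℕ).sum = n}
  have hfiber := hasSum_fintype fun _ : {m : o3Multisets // (m : Multiset ℕ).sum = n} => x ^ n
  rw [Finset.sum_const, Finset.card_univ, ← Nat.card_eq_fintype_card, ← o3_eq_card_fiber,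
    nsmul_eq_mul] at hfiber
  exact hfiber.congr_fun fun m => by simp [m.2]

lemma summable_prod_mul_pow_div_prod {q : ℂ} (hq : ‖q‖ < 1) :
    Summable fun n : ℕ =>
      (∏ j ∈ Finset.range (n + 1), (1 + q ^ (2 * j + 1))) * q ^ (2 * (n + 1)) /
          ∏ j ∈ Finset.range n, (1 - q ^ (2 * j + 2)) := by
  have hlim : Filter.Tendsto
      (fun n : ℕ => ‖(1 + q ^ (2 * n + 3)) * q ^ 2 / (1 - q ^ (2 * n + 2))‖)
      Filter.atTop (nhds ‖(1 + 0) * q ^ 2 / (1 - 0)‖) := by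
    have hpow (k : ℕ) : Filter.Tendsto (fun n : ℕ => q ^ (2 * n + k)) Filter.atTop (nhds 0) :=
      (tendsto_pow_atTop_nhds_zero_of_norm_lt_one hq).comp
        (Filter.tendsto_atTop_mono (fun n => by simp; omega) Filter.tendsto_id)
    exact ((((hpow 3).const_add 1).mul_const _).div ((hpow 2).const_sub 1) (by simp)).norm
  obtain ⟨r, hr, hr1⟩ : ∃ r, ‖(1 + 0) * q ^ 2 / (1 - 0)‖ < r ∧ r < 1 :=
    exists_between (by simpa using pow_lt_one₀ (norm_nonneg q) hq two_ne_zero)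
  refine summable_of_ratio_norm_eventually_le hr1 ?_
  filter_upwards [hlim.eventually_le_const hr] with n hn
  refine le_trans (le_of_eq ?_) (mul_le_mul_of_nonneg_right hn (norm_nonneg _))
  rw [← norm_mul, Finset.prod_range_succ _ (n + 1), Finset.prod_range_succ _ n,
    Finset.prod_range_succ _ n]
  congr 1
  simp only [div_eq_mul_inv, mul_inv]
  ring

lemma hasSum_pow_sum_cons {q : ℂ} (hq : ‖q‖ < 1) (n : ℕ) :
    HasSum (fun m : oddSimpleMultisets (2 * n + 1) => q ^ ((2 * n + 2) ::ₘ (m : Multiset ℕ)).sum)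
      ((∏ j ∈ Finset.range (n + 1), (1 + q ^ (2 * j + 1))) * q ^ (2 * (n + 1)) /
          ∏ j ∈ Finset.range n, (1 - q ^ (2 * j + 2))) := by
  have h := (hasSum_pow_sum_oddSimpleMultisets hq (2 * n + 1)).mul_left (q ^ (2 * n + 2))
  rw [prod_oddSimpleFactor] at h
  simp only [Multiset.sum_cons, pow_add _ (2 * n + 2)]
  rwa [mul_comm (∏ j ∈ _, _), mul_div_assoc]

lemma summable_pow_sum_cons {q : ℂ} (hq : ‖q‖ < 1) :
    Summable fun p : Σ n : ℕ, oddSimpleMultisets (2 * n + 1) =>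
      q ^ ((2 * p.1 + 2) ::ₘ (p.2 : Multiset ℕ)).sum := by
  refine Summable.of_norm ((summable_sigma_of_nonneg fun _ => norm_nonneg _).2
    ⟨fun n => (hasSum_pow_sum_cons hq n).summable.norm, ?_⟩)
  have hq' : ‖((‖q‖ : ℝ) : ℂ)‖ < 1 := by simpa using hq
  have h := (summable_prod_mul_pow_div_prod hq').norm
  refine h.congr fun n => ?_
  rw [← (hasSum_pow_sum_cons hq' n).tsum_eq]
  simp only [← Complex.ofReal_pow, ← Complex.ofReal_tsum, norm_pow]
  exact Complex.norm_of_nonneg (tsum_nonneg fun _ => by positivity)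

lemma hasSum_pow_sum_o3Multisets {q : ℂ} (hq : ‖q‖ < 1) :
    HasSum (fun m : o3Multisets => q ^ (m : Multiset ℕ).sum)
      (1 + ∑' n : ℕ,
        (∏ j ∈ Finset.range (n + 1), (1 + q ^ (2 * j + 1))) * q ^ (2 * (n + 1)) /
          ∏ j ∈ Finset.range n, (1 - q ^ (2 * j + 2))) := by
  have h := (summable_pow_sum_cons hq).hasSum
  have htsum := (h.sigma fun n => hasSum_pow_sum_cons hq n).tsum_eq
  rw [htsum, ← o3MultisetsEquiv.hasSum_iff, add_comm]
  refine HasSum.add_isCompl (Set.isCompl_range_some_none _)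
    ((Option.some_injective _).hasSum_range_iff.2 h) ?_
  have hnone : q ^ (o3MultisetsEquiv none : Multiset ℕ).sum = 1 := by
    simp [show (o3MultisetsEquiv none : Multiset ℕ) = 0 from rfl]
  rw [← hnone]
  exact hasSum_unique _

theorem o3_generating_function (q : ℂ) (hq : ‖q‖ < 1) :
    Summable (fun n : ℕ => ‖(o3 n : ℂ) * q ^ n‖) ∧
    ∑' n : ℕ, (o3 n : ℂ) * q ^ n =
      1 + ∑' n : ℕ,
        (∏ j ∈ Finset.range (n + 1), (1 + q ^ (2 * j + 1))) * q ^ (2 * (n + 1)) /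
          ∏ j ∈ Finset.range n, (1 - q ^ (2 * j + 2)) := by
  have h := hasSum_pow_sum_o3Multisets hq
  have hnorm : Summable fun m : o3Multisets => ‖q‖ ^ (m : Multiset ℕ).sum := by
    simpa only [norm_pow] using h.summable.norm
  exact ⟨by simpa using (hasSum_o3_mul_pow hnorm.hasSum).summable, (hasSum_o3_mul_pow h).tsum_eq⟩
end

section
/- For every complex number q with |q| < 1, \sum_{n=0}^{\infty} (q; q)_{2n} q^{4n} / (q^4; q^4)_n = \frac{(q; q)_{\infty}}{(q^4; q^4)_{\infty}} \sum_{m=0}^{\infty} \frac{(-q^2; q^2)_m q^{2m}}{(q; q^2)_m} + \frac{q (q; q)_{\infty}}{(q^2; q^4)_{\infty}} \sum_{m=0}^{\infty} \frac{(-q; q^2)_{m+1} q^{2m}}{(q^2; q^2)_m}, where all series converge absolutely. -/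
open Filter Topology

lemma one_add_mul_pow_ne_zero {c q : ℂ} (hc : ‖c‖ = 1) (hq : ‖q‖ < 1) {n : ℕ} (hn : n ≠ 0) :
    1 + c * q ^ n ≠ 0 := by
  intro h
  have h1 : ‖c * q ^ n‖ = 1 := by
    rw [eq_neg_of_add_eq_zero_right h, norm_neg, norm_one]
  rw [norm_mul, hc, one_mul, norm_pow] at h1
  exact (pow_lt_one₀ (norm_nonneg q) hq hn).ne h1

lemma summable_norm_mul_pow_arith {c q : ℂ} (hc : ‖c‖ = 1) (hq : ‖q‖ < 1) {k l : ℕ} (hk : k ≠ 0) :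
    Summable fun j : ℕ => ‖c * q ^ (k * j + l)‖ := by
  have h : Summable fun j : ℕ => (‖q‖ ^ k) ^ j * ‖q‖ ^ l :=
    (summable_geometric_of_lt_one (by positivity) (pow_lt_one₀ (norm_nonneg q) hq hk)).mul_right _
  refine h.congr fun j => ?_
  rw [norm_mul, hc, one_mul, norm_pow, pow_add, pow_mul]

lemma qProduct_facts {c q : ℂ} (hc : ‖c‖ = 1) (hq : ‖q‖ < 1) {k l : ℕ} (hk : k ≠ 0) (hl : l ≠ 0) :
    (∀ n : ℕ, ∏ j ∈ Finset.range n, (1 + c * q ^ (k * j + l)) ≠ 0) ∧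
    ∏' j : ℕ, (1 + c * q ^ (k * j + l)) ≠ 0 ∧
    Multipliable (fun j : ℕ => 1 + c * q ^ (k * j + l)) := by
  have h0 : ∀ j : ℕ, 1 + c * q ^ (k * j + l) ≠ 0 :=
    fun j => one_add_mul_pow_ne_zero hc hq (by omega)
  have hs := summable_norm_mul_pow_arith (l := l) hc hq hk
  exact ⟨fun n => Finset.prod_ne_zero_iff.2 fun j _ => h0 j,
    tprod_one_add_ne_zero_of_summable h0 hs, multipliable_one_add_of_summable hs⟩

lemma qProduct_sub_facts {q : ℂ} (hq : ‖q‖ < 1) {k l : ℕ} (hk : k ≠ 0) (hl : l ≠ 0) :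
    (∀ n : ℕ, ∏ j ∈ Finset.range n, (1 - q ^ (k * j + l)) ≠ 0) ∧
    ∏' j : ℕ, (1 - q ^ (k * j + l)) ≠ 0 ∧
    Multipliable (fun j : ℕ => 1 - q ^ (k * j + l)) := by
  simpa [← sub_eq_add_neg] using qProduct_facts (c := -1) (by simp) hq hk hl

lemma qProduct_add_facts {q : ℂ} (hq : ‖q‖ < 1) {k l : ℕ} (hk : k ≠ 0) (hl : l ≠ 0) :
    (∀ n : ℕ, ∏ j ∈ Finset.range n, (1 + q ^ (k * j + l)) ≠ 0) ∧
    ∏' j : ℕ, (1 + q ^ (k * j + l)) ≠ 0 ∧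
    Multipliable (fun j : ℕ => 1 + q ^ (k * j + l)) := by
  simpa using qProduct_facts (c := 1) (by simp) hq hk hl

lemma summable_norm_mul_pow_div {u v : ℕ → ℂ} {a b q : ℂ} (hu : Tendsto u atTop (𝓝 a))
    (hv : Tendsto v atTop (𝓝 b)) (hb : b ≠ 0) (hq : ‖q‖ < 1) {k : ℕ} (hk : k ≠ 0) :
    Summable fun n : ℕ => ‖u n * q ^ (k * n) / v n‖ := by
  have h1 : (fun n => u n / v n) =O[atTop] fun _ => (1 : ℝ) := (hu.div hv hb).isBigO_one ℝ
  have hs : Summable fun n : ℕ => (‖q‖ ^ k) ^ n :=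
    summable_geometric_of_lt_one (by positivity) (pow_lt_one₀ (norm_nonneg q) hq hk)
  refine summable_of_isBigO_nat hs ?_
  refine Asymptotics.IsBigO.norm_left ?_
  obtain ⟨C, hC⟩ := h1.bound
  refine Asymptotics.IsBigO.of_bound C (hC.mono fun n hn => ?_)
  rw [mul_div_right_comm, norm_mul, norm_pow, norm_pow, norm_pow, norm_norm, ← pow_mul]
  exact mul_le_mul_of_nonneg_right (by simpa using hn) (by positivity)

lemma tsum_eq_of_summable_norm_of_tendsto {f : ℕ → ℂ} {L : ℂ} (hf : Summable fun n => ‖f n‖)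
    {F : ℕ → ℂ} (hF : ∀ n, ∑ m ∈ Finset.range n, f m = F n) (hL : Tendsto F atTop (𝓝 L)) :
    ∑' n, f n = L :=
  tendsto_nhds_unique (hf.of_norm.hasSum.tendsto_sum_nat.congr hF) hL

lemma prod_range_two_mul_one_sub_pow (q : ℂ) (n : ℕ) :
    ∏ j ∈ Finset.range (2 * n), (1 - q ^ (j + 1)) =
      (∏ j ∈ Finset.range n, (1 - q ^ (2 * j + 1))) *
        ∏ j ∈ Finset.range n, (1 - q ^ (2 * j + 2)) := by
  induction n with
  | zero => simp
  | succ n ih =>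
    rw [show 2 * (n + 1) = 2 * n + 1 + 1 by ring, Finset.prod_range_succ, Finset.prod_range_succ,
      ih, Finset.prod_range_succ, Finset.prod_range_succ]
    ring

lemma sum_range_qProduct_alternating {q : ℂ} (hq : ‖q‖ < 1) (N : ℕ) :
    ∑ n ∈ Finset.range N, (∏ j ∈ Finset.range n, (1 - q ^ (2 * j + 1))) * q ^ (4 * n) /
        ∏ j ∈ Finset.range n, (1 + q ^ (2 * j + 2)) =
      ((1 + q ^ (2 * N)) * (1 - q - q ^ (2 * N)) *
        ((∏ j ∈ Finset.range N, (1 - q ^ (2 * j + 1))) /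
          ∏ j ∈ Finset.range N, (1 + q ^ (2 * j + 2))) + 2 * q) / (1 + q ^ 3) := by
  have h3 : 1 + q ^ 3 ≠ 0 := by
    simpa using one_add_mul_pow_ne_zero (c := 1) (by simp) hq (n := 3) (by norm_num)
  induction N with
  | zero => simp; ring
  | succ N ih =>
    have hP := (qProduct_add_facts hq (k := 2) (l := 2) (by norm_num) (by norm_num)).1 N
    have hN : 1 + q ^ (2 * N + 2) ≠ 0 := by
      simpa using one_add_mul_pow_ne_zero (c := 1) (by simp) hq (n := 2 * N + 2) (by omega)
    rw [Finset.sum_range_succ, ih, Finset.prod_range_succ, Finset.prod_range_succ]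
    generalize ∏ j ∈ Finset.range N, (1 - q ^ (2 * j + 1)) = X at *
    generalize ∏ j ∈ Finset.range N, (1 + q ^ (2 * j + 2)) = Y at *
    rw [show q ^ (4 * N) = q ^ (2 * N) * q ^ (2 * N) by ring,
      show 2 * (N + 1) = 2 * N + 2 by ring]
    rw [pow_add, pow_add] at *
    generalize q ^ (2 * N) = x at *
    field_simp
    ring

lemma sum_range_qProduct_even_div_odd {q : ℂ} (hq : ‖q‖ < 1) (N : ℕ) :
    ∑ m ∈ Finset.range N, (∏ j ∈ Finset.range m, (1 + q ^ (2 * j + 2))) * q ^ (2 * m) /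
        ∏ j ∈ Finset.range m, (1 - q ^ (2 * j + 1)) =
      ((q - q ^ (2 * N)) * ((∏ j ∈ Finset.range N, (1 + q ^ (2 * j + 2))) /
          ∏ j ∈ Finset.range N, (1 - q ^ (2 * j + 1))) + (1 - q)) / (1 + q ^ 3) := by
  have h3 : 1 + q ^ 3 ≠ 0 := by
    simpa using one_add_mul_pow_ne_zero (c := 1) (by simp) hq (n := 3) (by norm_num)
  induction N with
  | zero => simp
  | succ N ih =>
    have hP := (qProduct_sub_facts hq (k := 2) (l := 1) (by norm_num) (by norm_num)).1 N
    have hN : 1 - q ^ (2 * N + 1) ≠ 0 := by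
      simpa [← sub_eq_add_neg] using
        one_add_mul_pow_ne_zero (c := -1) (by simp) hq (n := 2 * N + 1) (by omega)
    rw [Finset.sum_range_succ, ih, Finset.prod_range_succ, Finset.prod_range_succ]
    generalize ∏ j ∈ Finset.range N, (1 - q ^ (2 * j + 1)) = X at *
    generalize ∏ j ∈ Finset.range N, (1 + q ^ (2 * j + 2)) = Y at *
    rw [show 2 * (N + 1) = 2 * N + 2 by ring]
    rw [pow_add, pow_add] at *
    rw [pow_one] at *
    generalize q ^ (2 * N) = x at *
    have hN' : 1 - q * x ≠ 0 := by rwa [mul_comm]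
    field_simp
    ring

lemma sum_range_qProduct_odd_div_even {q : ℂ} (hq : ‖q‖ < 1) (N : ℕ) :
    ∑ m ∈ Finset.range N, (∏ j ∈ Finset.range (m + 1), (1 + q ^ (2 * j + 1))) * q ^ (2 * m) /
        ∏ j ∈ Finset.range m, (1 - q ^ (2 * j + 2)) =
      (1 - q ^ (2 * N)) * ((∏ j ∈ Finset.range (N + 1), (1 + q ^ (2 * j + 1))) /
          ∏ j ∈ Finset.range N, (1 - q ^ (2 * j + 2))) / (1 + q ^ 3) := by
  have h3 : 1 + q ^ 3 ≠ 0 := by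
    simpa using one_add_mul_pow_ne_zero (c := 1) (by simp) hq (n := 3) (by norm_num)
  induction N with
  | zero => simp
  | succ N ih =>
    have hP := (qProduct_sub_facts hq (k := 2) (l := 2) (by norm_num) (by norm_num)).1 N
    have hN : 1 - q ^ (2 * N + 2) ≠ 0 := by
      simpa [← sub_eq_add_neg] using
        one_add_mul_pow_ne_zero (c := -1) (by simp) hq (n := 2 * N + 2) (by omega)
    rw [Finset.sum_range_succ, ih, Finset.prod_range_succ _ (N + 1),
      Finset.prod_range_succ (fun j => 1 - q ^ (2 * j + 2))]
    generalize ∏ j ∈ Finset.range (N + 1), (1 + q ^ (2 * j + 1)) = X at *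
    generalize ∏ j ∈ Finset.range N, (1 - q ^ (2 * j + 2)) = Y at *
    rw [show 2 * (N + 1) = 2 * N + 2 by ring, show 2 * N + 2 + 1 = 2 * N + 3 by ring]
    rw [pow_add, pow_add] at *
    generalize q ^ (2 * N) = x at *
    field_simp
    ring


theorem sum_split_identity (q : ℂ) (hq : ‖q‖ < 1) :
    Summable (fun n : ℕ =>
      ‖(∏ j ∈ Finset.range (2 * n), (1 - q ^ (j + 1))) * q ^ (4 * n) /
        ∏ j ∈ Finset.range n, (1 - q ^ (4 * j + 4))‖) ∧
    Summable (fun m : ℕ =>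
      ‖(∏ j ∈ Finset.range m, (1 + q ^ (2 * j + 2))) * q ^ (2 * m) /
        ∏ j ∈ Finset.range m, (1 - q ^ (2 * j + 1))‖) ∧
    Summable (fun m : ℕ =>
      ‖(∏ j ∈ Finset.range (m + 1), (1 + q ^ (2 * j + 1))) * q ^ (2 * m) /
        ∏ j ∈ Finset.range m, (1 - q ^ (2 * j + 2))‖) ∧
    ∑' n : ℕ, (∏ j ∈ Finset.range (2 * n), (1 - q ^ (j + 1))) * q ^ (4 * n) /
        ∏ j ∈ Finset.range n, (1 - q ^ (4 * j + 4)) =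
      (∏' j : ℕ, (1 - q ^ (j + 1))) / (∏' j : ℕ, (1 - q ^ (4 * j + 4))) *
          ∑' m : ℕ, (∏ j ∈ Finset.range m, (1 + q ^ (2 * j + 2))) * q ^ (2 * m) /
            ∏ j ∈ Finset.range m, (1 - q ^ (2 * j + 1)) +
        q * (∏' j : ℕ, (1 - q ^ (j + 1))) / (∏' j : ℕ, (1 - q ^ (4 * j + 2))) *
          ∑' m : ℕ, (∏ j ∈ Finset.range (m + 1), (1 + q ^ (2 * j + 1))) * q ^ (2 * m) /
            ∏ j ∈ Finset.range m, (1 - q ^ (2 * j + 2)) := by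
  obtain ⟨-, -, hEm⟩ := qProduct_sub_facts hq (k := 1) (l := 1) (by norm_num) (by norm_num)
  obtain ⟨-, ha0, ham⟩ := qProduct_sub_facts hq (k := 2) (l := 1) (by norm_num) (by norm_num)
  obtain ⟨hbn, hb0, hbm⟩ := qProduct_sub_facts hq (k := 2) (l := 2) (by norm_num) (by norm_num)
  obtain ⟨-, hc0, hcm⟩ := qProduct_add_facts hq (k := 2) (l := 2) (by norm_num) (by norm_num)
  obtain ⟨-, hd0, hdm⟩ := qProduct_add_facts hq (k := 2) (l := 1) (by norm_num) (by norm_num)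
  simp only [one_mul] at hEm
  have h3 : 1 + q ^ 3 ≠ 0 := by
    simpa using one_add_mul_pow_ne_zero (c := 1) (by simp) hq (n := 3) (by norm_num)
  have hE : ∏' j : ℕ, (1 - q ^ (j + 1)) =
      (∏' j : ℕ, (1 - q ^ (2 * j + 1))) * ∏' j : ℕ, (1 - q ^ (2 * j + 2)) := by
    refine tendsto_nhds_unique
      (hEm.tendsto_prod_tprod_nat.comp (tendsto_id.const_mul_atTop' two_pos)) ?_
    refine (ham.tendsto_prod_tprod_nat.mul hbm.tendsto_prod_tprod_nat).congr fun n => ?_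
    exact (prod_range_two_mul_one_sub_pow q n).symm
  have hA : ∏' j : ℕ, (1 - q ^ (4 * j + 4)) =
      (∏' j : ℕ, (1 - q ^ (2 * j + 2))) * ∏' j : ℕ, (1 + q ^ (2 * j + 2)) := by
    rw [← hbm.tprod_mul hcm]
    exact tprod_congr fun j => by ring
  have hB : ∏' j : ℕ, (1 - q ^ (4 * j + 2)) =
      (∏' j : ℕ, (1 - q ^ (2 * j + 1))) * ∏' j : ℕ, (1 + q ^ (2 * j + 1)) := by
    rw [← ham.tprod_mul hdm]
    exact tprod_congr fun j => by ring
  have hterm : ∀ n : ℕ, (∏ j ∈ Finset.range (2 * n), (1 - q ^ (j + 1))) * q ^ (4 * n) /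
        ∏ j ∈ Finset.range n, (1 - q ^ (4 * j + 4)) =
      (∏ j ∈ Finset.range n, (1 - q ^ (2 * j + 1))) * q ^ (4 * n) /
        ∏ j ∈ Finset.range n, (1 + q ^ (2 * j + 2)) := fun n => by
    have h4 : ∏ j ∈ Finset.range n, (1 - q ^ (4 * j + 4)) =
        (∏ j ∈ Finset.range n, (1 - q ^ (2 * j + 2))) *
          ∏ j ∈ Finset.range n, (1 + q ^ (2 * j + 2)) := by
      rw [← Finset.prod_mul_distrib]
      exact Finset.prod_congr rfl fun j _ => by ring
    rw [prod_range_two_mul_one_sub_pow, h4, mul_right_comm, mul_comm (∏ j ∈ _, (1 - q ^ (2 * j + 2))),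
      mul_div_mul_right _ _ (hbn n)]
  simp only [hterm, hE, hA, hB]
  have ta := ham.tendsto_prod_tprod_nat
  have tb := hbm.tendsto_prod_tprod_nat
  have tc := hcm.tendsto_prod_tprod_nat
  have td := (tendsto_add_atTop_iff_nat 1).2 hdm.tendsto_prod_tprod_nat
  have hx : Tendsto (fun n : ℕ => q ^ (2 * n)) atTop (𝓝 0) :=
    (tendsto_pow_atTop_nhds_zero_of_norm_lt_one hq).comp (tendsto_id.const_mul_atTop' two_pos)
  have s1 := summable_norm_mul_pow_div ta tc hc0 hq (k := 4) (by norm_num)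
  have s2 := summable_norm_mul_pow_div tc ta ha0 hq (k := 2) (by norm_num)
  have s3 := summable_norm_mul_pow_div td tb hb0 hq (k := 2) (by norm_num)
  refine ⟨s1, s2, s3, ?_⟩
  rw [tsum_eq_of_summable_norm_of_tendsto s1 (sum_range_qProduct_alternating hq)
      (((((hx.const_add 1).mul (hx.const_sub (1 - q))).mul (ta.div tc hc0)).add_const _).div_const _),
    tsum_eq_of_summable_norm_of_tendsto s2 (sum_range_qProduct_even_div_odd hq)
      ((((hx.const_sub q).mul (tc.div ta ha0)).add_const _).div_const _),
    tsum_eq_of_summable_norm_of_tendsto s3 (sum_range_qProduct_odd_div_even hq)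
      (((hx.const_sub 1).mul (td.div tb hb0)).div_const _)]
  field_simp
  ring
end
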